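/- Let $Z$ be a geodesic metric space homeomorphic to $\overline{D}$ with boundary circle $\partial Z$, and suppose every Jordan curve $T\subset Z$ with $\ell_Z(T)<l_0$ bounds a Jordan domain $\Omega$ with $\mathcal H^2(\Omega)\leq C\,\ell_Z(T)^2$. Then for every $z_0\in Z$ and every $0\leq r<d_Z(z_0,\partial Z)$: $\mathcal H^2(B(z_0,r))\geq\min\{\tfrac{\pi^2}{64 C}\,r^2,\;C l_0^2\}$, provided additionally that $\mathcal H^2(B(z_0,r'))>0$ for all $z_0\in Z$ and $r'>0$. -/

import Mathlib

open Set MeasureTheory Metric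
open scoped ENNReal Real

/-- A geodesic metric space: any two points are joined by an isometrically parametrized
segment. -/
def IsGeodesicSpace (Z : Type*) [MetricSpace Z] : Prop :=
  ∀ x y : Z, ∃ γ : ℝ → Z, γ 0 = x ∧ γ (dist x y) = y ∧
    ∀ s ∈ Icc (0 : ℝ) (dist x y), ∀ t ∈ Icc (0 : ℝ) (dist x y),
      dist (γ s) (γ t) = |s - t|

/-- `f` admits a continuous logarithm on `S`. -/
def HasLogOn {X : Type*} [TopologicalSpace X] (f : X → ℂ) (S : Set X) : Prop :=
  ∃ g : X → ℂ, ContinuousOn g S ∧ ∀ x ∈ S, Complex.exp (g x) = f x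

theorem HasLogOn.mono {X : Type*} [TopologicalSpace X] {f : X → ℂ} {S T : Set X}
    (h : HasLogOn f T) (hST : S ⊆ T) : HasLogOn f S := by
  obtain ⟨g, hg, hgf⟩ := h
  exact ⟨g, hg.mono hST, fun x hx ↦ hgf x (hST hx)⟩

/-- Two continuous logarithms of the same function differ by a constant on preconnected sets. -/
theorem sub_eq_sub_of_exp_eq {X : Type*} [TopologicalSpace X] {S : Set X} (hS : IsPreconnected S)
    {g₁ g₂ : X → ℂ} (h₁ : ContinuousOn g₁ S) (h₂ : ContinuousOn g₂ S)
    (h : ∀ x ∈ S, Complex.exp (g₁ x) = Complex.exp (g₂ x)) {x y : X} (hx : x ∈ S) (hy : y ∈ S) :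
    g₁ x - g₂ x = g₁ y - g₂ y := by
  have key := Complex.isCoveringMap_exp.eqOn_of_comp_eqOn hS (h₁.sub h₂)
    (continuousOn_const (c := g₁ x - g₂ x)) (fun z hz ↦ by
      have e : ∀ z ∈ S, Complex.exp (g₁ z - g₂ z) = 1 := fun z hz ↦ by
        rw [Complex.exp_sub, h z hz, div_self (Complex.exp_ne_zero _)]
      simp only [Function.comp, Subtype.mk.injEq, Pi.sub_apply]
      rw [e z hz, e x hx]) hx (by simp)
  exact (key hy).symm

/-- A nonvanishing continuous function on the plane has a continuous logarithm. -/
theorem exists_continuous_log {F : ℂ → ℂ} (hF : Continuous F) (h0 : ∀ z, F z ≠ 0) :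
    ∃ H : ℂ → ℂ, Continuous H ∧ ∀ z, Complex.exp (H z) = F z := by
  obtain ⟨H, ⟨-, hH⟩, -⟩ := Complex.isCoveringMap_exp.existsUnique_continuousMap_lifts
    (⟨fun z ↦ ⟨F z, h0 z⟩, by fun_prop⟩ : C(ℂ, {z : ℂ // z ≠ 0})) (0 : ℂ) (Complex.log (F 0))
    (by ext; simp [Complex.exp_log (h0 0)])
  refine ⟨H, H.continuous, fun z ↦ ?_⟩
  simpa using congrArg Subtype.val (congrFun hH z)

/-- For a bounded plane set containing `w₀`, the function `w - w₀` has no continuous logarithm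
on the frontier. -/
theorem not_hasLogOn_frontier {U : Set ℂ} (hb : Bornology.IsBounded U) {w₀ : ℂ}
    (hw₀ : w₀ ∈ U) : ¬ HasLogOn (fun w ↦ w - w₀) (frontier U) := by
  classical
  rintro ⟨g, hg, hgf⟩
  obtain ⟨G, hG⟩ := ContinuousMap.exists_restrict_eq (isClosed_frontier (s := U))
    (⟨(frontier U).domRestrict g, hg.domRestrict⟩ : C(frontier U, ℂ))
  have hGg : ∀ x ∈ frontier U, G x = g x := fun x hx ↦ by
    exact congrArg (fun k : C(frontier U, ℂ) ↦ k ⟨x, hx⟩) hG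
  let F : ℂ → ℂ := fun w ↦ if w ∈ U then Complex.exp (G w) else w - w₀
  have hF : Continuous F := by
    refine continuous_if (fun w hw ↦ ?_) ?_ ?_
    · have hw' : w ∈ frontier U := hw
      rw [hGg w hw', hgf w hw']
    · fun_prop
    · fun_prop
  have hF0 : ∀ w, F w ≠ 0 := by
    intro w
    by_cases hw : w ∈ U
    · simp [F, hw]
    · simp only [F, hw, if_false]
      exact sub_ne_zero.2 fun h ↦ hw (h ▸ hw₀)
  obtain ⟨H, hH, hHF⟩ := exists_continuous_log hF hF0
  obtain ⟨R, hR⟩ := hb.subset_ball w₀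
  have hR0 : 0 < R := by simpa using hR hw₀
  let β : ℝ → ℂ := fun t ↦ w₀ + R * Complex.exp (t * Complex.I)
  have hβ : Continuous β := by fun_prop
  have hFβ : ∀ t, F (β t) = R * Complex.exp (t * Complex.I) := by
    intro t
    have : β t ∉ U := by
      intro h
      have := hR h
      simp [β, Complex.norm_exp, abs_of_pos hR0, dist_eq_norm] at this
    simp [F, this, β]
  have key := sub_eq_sub_of_exp_eq isPreconnected_univ (g₁ := fun t ↦ H (β t))
    (g₂ := fun t : ℝ ↦ Complex.log R + t * Complex.I) (by fun_prop) (by fun_prop)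
    (fun t _ ↦ by
      rw [hHF, hFβ, Complex.exp_add, Complex.exp_log (by exact_mod_cast hR0.ne')])
    (mem_univ 0) (mem_univ (2 * π))
  have hβ' : β (2 * π) = β 0 := by
    simp [β, Complex.exp_two_pi_mul_I]
  simp [hβ', Complex.I_ne_zero, Real.pi_ne_zero] at key

theorem div_mem_slitPlane {a b : ℂ} (h : ‖b - a‖ < ‖a‖) : b / a ∈ Complex.slitPlane := by
  have ha : a ≠ 0 := fun h0 ↦ by simp [h0, (norm_nonneg b).not_gt] at h
  have : b / a = 1 + (b - a) / a := by field_simp; ring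
  rw [this]
  refine Complex.mem_slitPlane_of_norm_lt_one ?_
  rwa [norm_div, div_lt_one (norm_pos_iff.2 ha)]

theorem continuousOn_log_div {X : Type*} [TopologicalSpace X] {f₁ f₂ : X → ℂ} {S : Set X}
    (h₁ : ContinuousOn f₁ S) (h₂ : ContinuousOn f₂ S) (h : ∀ x ∈ S, ‖f₂ x - f₁ x‖ < ‖f₁ x‖) :
    ContinuousOn (fun x ↦ Complex.log (f₂ x / f₁ x)) S := by
  refine (h₂.div h₁ fun x hx h0 ↦ ?_).clog fun x hx ↦ div_mem_slitPlane (h x hx)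
  have := h x hx
  simp [h0, (norm_nonneg (f₂ x)).not_gt] at this

theorem exp_log_div {a b : ℂ} (h : ‖b - a‖ < ‖a‖) :
    Complex.exp (Complex.log (b / a)) = b / a :=
  Complex.exp_log (Complex.slitPlane_ne_zero (div_mem_slitPlane h))

theorem hasLogOn_iff_of_norm_sub_lt {X : Type*} [TopologicalSpace X] {f₁ f₂ : X → ℂ} {S : Set X}
    (h₁ : ContinuousOn f₁ S) (h₂ : ContinuousOn f₂ S) (h : ∀ x ∈ S, ‖f₂ x - f₁ x‖ < ‖f₁ x‖) :
    HasLogOn f₁ S ↔ HasLogOn f₂ S := by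
  have hlog := continuousOn_log_div h₁ h₂ h
  have hne : ∀ x ∈ S, f₁ x ≠ 0 ∧ f₂ x ≠ 0 := fun x hx ↦ by
    have := Complex.slitPlane_ne_zero (div_mem_slitPlane (h x hx))
    rw [div_ne_zero_iff] at this
    exact this.symm
  constructor
  · rintro ⟨g, hg, hgf⟩
    refine ⟨_, hg.add hlog, fun x hx ↦ ?_⟩
    rw [Pi.add_apply, Complex.exp_add, hgf x hx, exp_log_div (h x hx), mul_div_cancel₀ _ (hne x hx).1]
  · rintro ⟨g, hg, hgf⟩
    refine ⟨_, hg.sub hlog, fun x hx ↦ ?_⟩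
    rw [Pi.sub_apply, Complex.exp_sub, hgf x hx, exp_log_div (h x hx), div_div_cancel₀ (hne x hx).2]

/-- If `w₀` and `w₁` lie in a connected set missing the image of `T` under `e`, then a logarithm of
`e - w₁` on `T` yields one of `e - w₀`. -/
theorem HasLogOn.of_isPreconnected {X : Type*} [TopologicalSpace X] {T : Set X}
    (hT : IsCompact T) {e : X → ℂ} (he : ContinuousOn e T) {V : Set ℂ} (hV : IsPreconnected V)
    (hVT : ∀ x ∈ T, e x ∉ V) {w₀ w₁ : ℂ} (h₀ : w₀ ∈ V) (h₁ : w₁ ∈ V)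
    (h : HasLogOn (fun x ↦ e x - w₁) T) : HasLogOn (fun x ↦ e x - w₀) T := by
  have hcl : IsClosed (e '' T) := (hT.image_of_continuousOn he).isClosed
  refine (hV.induction₂ (fun a b ↦ HasLogOn (fun x ↦ e x - a) T ↔ HasLogOn (fun x ↦ e x - b) T)
    (fun a ha ↦ ?_) (fun a b c _ _ _ ↦ Iff.trans) (fun _ _ _ _ ↦ Iff.symm) h₁ h₀).1 h
  have haT : a ∈ (e '' T)ᶜ := by
    rintro ⟨x, hx, rfl⟩
    exact hVT x hx ha
  obtain ⟨δ, hδ, hball⟩ := Metric.isOpen_iff.1 hcl.isOpen_compl a haT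
  refine mem_nhdsWithin_of_mem_nhds (Filter.mem_of_superset (ball_mem_nhds a hδ) fun b hb ↦ ?_)
  refine hasLogOn_iff_of_norm_sub_lt (by fun_prop) (by fun_prop) fun x hx ↦ ?_
  have hxa : δ ≤ ‖e x - a‖ := by
    by_contra! hlt
    exact hball (mem_ball_iff_norm.2 hlt) (mem_image_of_mem e hx)
  have : e x - b - (e x - a) = -(b - a) := by ring
  rw [this, norm_neg]
  exact (mem_ball_iff_norm.1 hb).trans_le hxa

/-- A `1`-Lipschitz path `γ` in `N` parametrized by `[0, ℓ]` with a continuous logarithm `θ` of `f`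
along it. -/
structure IsLogPath {Z : Type*} [MetricSpace Z] (f : Z → ℂ) (N : Set Z) (ℓ : ℝ) (γ : ℝ → Z)
    (θ : ℝ → ℂ) : Prop where
  nonneg : 0 ≤ ℓ
  dist_le : ∀ s ∈ Icc 0 ℓ, ∀ t ∈ Icc 0 ℓ, dist (γ s) (γ t) ≤ |s - t|
  mem : ∀ s ∈ Icc 0 ℓ, γ s ∈ N
  continuousOn : ContinuousOn θ (Icc 0 ℓ)
  exp_eq : ∀ s ∈ Icc 0 ℓ, Complex.exp (θ s) = f (γ s)

/-- There is a path in `N` from `a` to `b` of length at most `ℓ` along which a logarithm of `f`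
changes by `w`. -/
def LogPath {Z : Type*} [MetricSpace Z] (f : Z → ℂ) (N : Set Z) (a b : Z) (ℓ : ℝ) (w : ℂ) :
    Prop :=
  ∃ γ : ℝ → Z, ∃ θ : ℝ → ℂ, IsLogPath f N ℓ γ θ ∧ γ 0 = a ∧ γ ℓ = b ∧ θ ℓ - θ 0 = w

section

variable {Z : Type*} [MetricSpace Z] {f : Z → ℂ} {N : Set Z}

theorem IsLogPath.lipschitzOnWith {ℓ : ℝ} {γ : ℝ → Z} {θ : ℝ → ℂ} (h : IsLogPath f N ℓ γ θ) :
    LipschitzOnWith 1 γ (Icc 0 ℓ) :=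
  LipschitzOnWith.of_dist_le_mul fun s hs t ht ↦ by
    simpa [Real.dist_eq] using h.dist_le s hs t ht

theorem IsLogPath.logPath_sub {ℓ : ℝ} {γ : ℝ → Z} {θ : ℝ → ℂ} (h : IsLogPath f N ℓ γ θ) {s t : ℝ}
    (hs : 0 ≤ s) (hst : s ≤ t) (ht : t ≤ ℓ) : LogPath f N (γ s) (γ t) (t - s) (θ t - θ s) := by
  have hmem : ∀ u ∈ Icc 0 (t - s), s + u ∈ Icc 0 ℓ := fun u hu ↦
    ⟨by linarith [hu.1], by linarith [hu.2]⟩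
  refine ⟨fun u ↦ γ (s + u), fun u ↦ θ (s + u), ⟨by linarith, fun u hu v hv ↦ ?_,
    fun u hu ↦ h.mem _ (hmem u hu), h.continuousOn.comp (by fun_prop) hmem,
    fun u hu ↦ h.exp_eq _ (hmem u hu)⟩, by simp, by simp, by simp⟩
  simpa using h.dist_le _ (hmem u hu) _ (hmem v hv)

theorem LogPath.trans {a b c : Z} {ℓ₁ ℓ₂ : ℝ} {w₁ w₂ : ℂ} (h₁ : LogPath f N a b ℓ₁ w₁)
    (h₂ : LogPath f N b c ℓ₂ w₂) : LogPath f N a c (ℓ₁ + ℓ₂) (w₁ + w₂) := by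
  obtain ⟨γ₁, θ₁, p₁, rfl, rfl, rfl⟩ := h₁
  obtain ⟨γ₂, θ₂, p₂, h0, rfl, rfl⟩ := h₂
  have n₁ := p₁.nonneg
  have n₂ := p₂.nonneg
  set γ : ℝ → Z := fun t ↦ if t ≤ ℓ₁ then γ₁ t else γ₂ (t - ℓ₁) with hγ
  set θ : ℝ → ℂ := fun t ↦ if t ≤ ℓ₁ then θ₁ t else θ₂ (t - ℓ₁) + (θ₁ ℓ₁ - θ₂ 0) with hθ
  have γl : ∀ t, t ≤ ℓ₁ → γ t = γ₁ t := fun t ht ↦ by simp [hγ, ht]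
  have θl : ∀ t, t ≤ ℓ₁ → θ t = θ₁ t := fun t ht ↦ by simp [hθ, ht]
  have γr : ∀ t, ℓ₁ ≤ t → γ t = γ₂ (t - ℓ₁) := fun t ht ↦ by
    rcases ht.eq_or_lt with rfl | ht
    · simp [hγ, h0]
    · simp [hγ, ht.not_ge]
  have θr : ∀ t, ℓ₁ ≤ t → θ t = θ₂ (t - ℓ₁) + (θ₁ ℓ₁ - θ₂ 0) := fun t ht ↦ by
    rcases ht.eq_or_lt with rfl | ht
    · simp [hθ]
    · simp [hθ, ht.not_ge]
  have hexp0 : Complex.exp (θ₁ ℓ₁ - θ₂ 0) = 1 := by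
    rw [Complex.exp_sub, p₁.exp_eq ℓ₁ ⟨n₁, le_rfl⟩, p₂.exp_eq 0 ⟨le_rfl, n₂⟩, h0, div_self]
    rw [← p₁.exp_eq ℓ₁ ⟨n₁, le_rfl⟩]
    exact Complex.exp_ne_zero _
  have mr : ∀ t, ℓ₁ ≤ t → t ≤ ℓ₁ + ℓ₂ → t - ℓ₁ ∈ Icc 0 ℓ₂ := fun t h h' ↦
    ⟨by linarith, by linarith⟩
  have hmix : ∀ s ∈ Icc 0 (ℓ₁ + ℓ₂), ∀ t ∈ Icc 0 (ℓ₁ + ℓ₂), s ≤ t →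
      dist (γ s) (γ t) ≤ |s - t| := by
    intro s hs t ht hst
    rcases le_total t ℓ₁ with h | h
    · rw [γl s (hst.trans h), γl t h]
      exact p₁.dist_le _ ⟨hs.1, hst.trans h⟩ _ ⟨ht.1, h⟩
    rcases le_total s ℓ₁ with h' | h'
    · have e₁ := p₁.dist_le s ⟨hs.1, h'⟩ ℓ₁ ⟨n₁, le_rfl⟩
      have e₂ := p₂.dist_le 0 ⟨le_rfl, n₂⟩ _ (mr t h ht.2)
      rw [γl s h', γr t h]
      refine (dist_triangle _ (γ₁ ℓ₁) _).trans ?_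
      rw [h0] at e₂
      rw [abs_sub_comm, abs_of_nonneg (by linarith)] at e₁ e₂ ⊢
      linarith
    · rw [γr s h', γr t h]
      simpa using p₂.dist_le _ (mr s h' hs.2) _ (mr t h ht.2)
  refine ⟨γ, θ, ⟨by linarith, fun s hs t ht ↦ ?_, fun s hs ↦ ?_, ?_, fun s hs ↦ ?_⟩,
    by rw [γl 0 n₁], by rw [γr _ (by linarith)]; simp, ?_⟩
  · rcases le_total s t with h | h
    · exact hmix s hs t ht h
    · rw [dist_comm, abs_sub_comm]
      exact hmix t ht s hs h
  · rcases le_total s ℓ₁ with h | h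
    · rw [γl s h]
      exact p₁.mem s ⟨hs.1, h⟩
    · rw [γr s h]
      exact p₂.mem _ (mr s h hs.2)
  · have hU : Icc 0 (ℓ₁ + ℓ₂) = Icc 0 ℓ₁ ∪ Icc ℓ₁ (ℓ₁ + ℓ₂) :=
      (Icc_union_Icc_eq_Icc n₁ (by linarith)).symm
    rw [hU]
    refine ContinuousOn.union_of_isClosed ?_ ?_ isClosed_Icc isClosed_Icc
    · exact p₁.continuousOn.congr fun t ht ↦ θl t ht.2
    · refine ContinuousOn.congr (f := fun t ↦ θ₂ (t - ℓ₁) + (θ₁ ℓ₁ - θ₂ 0)) ?_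
        fun t ht ↦ θr t ht.1
      exact (p₂.continuousOn.comp (by fun_prop) fun t ht ↦ mr t ht.1 ht.2).add continuousOn_const
  · rcases le_total s ℓ₁ with h | h
    · rw [γl s h, θl s h]
      exact p₁.exp_eq s ⟨hs.1, h⟩
    · rw [γr s h, θr s h, Complex.exp_add, hexp0, mul_one]
      exact p₂.exp_eq _ (mr s h hs.2)
  · rw [θr _ (by linarith), θl 0 n₁]
    simp only [add_sub_cancel_left]
    ring

/-- The loops in `N` along which logarithms of `f` are multivalued. -/
def essentialLoops (f : Z → ℂ) (N : Set Z) : Set (BoundedContinuousFunction unitInterval Z) :=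
  {α | α 0 = α 1 ∧ (∀ t, α t ∈ N) ∧
    ∃ θ : unitInterval → ℂ, Continuous θ ∧ (∀ t, Complex.exp (θ t) = f (α t)) ∧ θ 0 ≠ θ 1}

theorem LogPath.exists_essentialLoop {a : Z} {ℓ : ℝ} {w : ℂ} (h : LogPath f N a a ℓ w)
    (hw : w ≠ 0) : ∃ α ∈ essentialLoops f N, ∀ s t, dist (α s) (α t) ≤ ℓ * dist s t := by
  obtain ⟨γ, θ, p, h0, h1, rfl⟩ := h
  have hm : ∀ t : unitInterval, ℓ * (t : ℝ) ∈ Icc 0 ℓ := fun t ↦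
    ⟨mul_nonneg p.nonneg t.2.1, mul_le_of_le_one_right p.nonneg t.2.2⟩
  have hc : Continuous fun t : unitInterval ↦ γ (ℓ * t) :=
    p.lipschitzOnWith.continuousOn.comp_continuous (by fun_prop) hm
  refine ⟨BoundedContinuousFunction.mkOfCompact ⟨_, hc⟩, ⟨?_, fun t ↦ ?_, fun t ↦ θ (ℓ * t),
    p.continuousOn.comp_continuous (by fun_prop) hm, fun t ↦ ?_, ?_⟩, fun s t ↦ ?_⟩
  · simp [h0, h1]
  · exact p.mem _ (hm t)
  · exact p.exp_eq _ (hm t)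
  · simpa [sub_ne_zero] using hw.symm ∘ fun h ↦ by simp [h]
  · refine (p.dist_le _ (hm s) _ (hm t)).trans_eq ?_
    rw [← mul_sub, abs_mul, abs_of_nonneg p.nonneg]
    rfl

theorem exists_isLogPath_of_mem_essentialLoops {α : BoundedContinuousFunction unitInterval Z}
    (hα : α ∈ essentialLoops f N) {ℓ : ℝ} (hℓ : 0 ≤ ℓ)
    (h : ∀ s t, dist (α s) (α t) ≤ ℓ * dist s t) :
    0 < ℓ ∧ ∃ γ : ℝ → Z, ∃ θ : ℝ → ℂ, IsLogPath f N ℓ γ θ ∧ γ 0 = γ ℓ ∧ θ 0 ≠ θ ℓ := by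
  obtain ⟨h01, hN, θ, hθ, hexp, hne⟩ := hα
  have hpos : 0 < ℓ := by
    rcases hℓ.eq_or_lt with rfl | hpos
    · exfalso
      have hconst : ∀ s, α s = α 0 := fun s ↦ by simpa using h s 0
      have := sub_eq_sub_of_exp_eq (isPreconnected_univ (α := unitInterval)) hθ.continuousOn
        (continuousOn_const (c := θ 0)) (fun s _ ↦ by rw [hexp, hexp, hconst s])
        (mem_univ 0) (mem_univ 1)
      simp only [sub_left_inj] at this
      exact hne this
    · exact hpos
  refine ⟨hpos, fun t ↦ α (projIcc 0 1 zero_le_one (t / ℓ)),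
    fun t ↦ θ (projIcc 0 1 zero_le_one (t / ℓ)), ⟨hℓ, fun s hs t ht ↦ ?_, fun s _ ↦ hN _,
      ?_, fun s _ ↦ hexp _⟩, ?_, ?_⟩
  · have hm : ∀ u ∈ Icc 0 ℓ, u / ℓ ∈ Icc (0 : ℝ) 1 := fun u hu ↦
      ⟨div_nonneg hu.1 hℓ, div_le_one_of_le₀ hu.2 hℓ⟩
    refine (h _ _).trans_eq ?_
    rw [projIcc_of_mem _ (hm s hs), projIcc_of_mem _ (hm t ht), Subtype.dist_eq, Real.dist_eq,
      ← sub_div, abs_div, abs_of_pos hpos, mul_div_cancel₀ _ hpos.ne']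
  · exact (hθ.comp (continuous_projIcc.comp (by fun_prop))).continuousOn
  · simpa [hpos.ne'] using h01
  · simpa [hpos.ne'] using hne

theorem isClosed_essentialLoops [CompactSpace Z] (hf : Continuous f) (hN : IsClosed N)
    (hfN : ∀ x ∈ N, f x ≠ 0) : IsClosed (essentialLoops f N) := by
  refine isClosed_of_closure_subset fun α hα ↦ ?_
  have h1 : α 0 = α 1 := by
    have : IsClosed {α : BoundedContinuousFunction unitInterval Z | α 0 = α 1} :=
      isClosed_eq (by fun_prop) (by fun_prop)
    exact closure_minimal (fun β hβ ↦ hβ.1) this hα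
  have h2 : ∀ t, α t ∈ N := fun t ↦ by
    have : IsClosed {α : BoundedContinuousFunction unitInterval Z | α t ∈ N} :=
      hN.preimage (by fun_prop)
    exact closure_minimal (fun β hβ ↦ hβ.2.1 t) this hα
  obtain ⟨c, hc, hcN⟩ : ∃ c > 0, ∀ x ∈ N, c ≤ ‖f x‖ := by
    rcases N.eq_empty_or_nonempty with rfl | hne
    · exact ⟨1, one_pos, by simp⟩
    obtain ⟨x, hx, hmin⟩ := hN.isCompact.exists_isMinOn hne hf.norm.continuousOn
    exact ⟨‖f x‖, norm_pos_iff.2 (hfN x hx), fun y hy ↦ hmin hy⟩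
  obtain ⟨δ, hδ, hδf⟩ := Metric.uniformContinuous_iff.1
    (CompactSpace.uniformContinuous_of_continuous hf) c hc
  obtain ⟨β, hβ, hαβ⟩ := Metric.mem_closure_iff.1 hα δ hδ
  obtain ⟨hβ01, hβN, θ, hθ, hexp, hne⟩ := hβ
  have hlt : ∀ t, ‖f (α t) - f (β t)‖ < ‖f (β t)‖ := fun t ↦ by
    rw [← dist_eq_norm]
    exact (hδf ((BoundedContinuousFunction.dist_coe_le_dist t).trans_lt hαβ)).trans_le
      (hcN _ (hβN t))
  have hlog := continuousOn_log_div (S := univ) (f₁ := fun t ↦ f (β t)) (f₂ := fun t ↦ f (α t))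
    (by fun_prop) (by fun_prop) fun t _ ↦ hlt t
  refine ⟨h1, h2, fun t ↦ θ t + Complex.log (f (α t) / f (β t)),
    hθ.add (continuousOn_univ.1 hlog), fun t ↦ ?_, ?_⟩
  · rw [Complex.exp_add, hexp, exp_log_div (hlt t), mul_div_cancel₀ _ (hfN _ (hβN t))]
  · simpa [h1, hβ01] using hne

/-- A shortest loop along which logarithms of `f` are multivalued is simple. -/
theorem LogPath.exists_injOn [CompactSpace Z] (hf : Continuous f) (hN : IsClosed N)
    (hfN : ∀ x ∈ N, f x ≠ 0) {a : Z} {L : ℝ} {w : ℂ} (h : LogPath f N a a L w) (hw : w ≠ 0) :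
    ∃ ℓ γ θ, 0 < ℓ ∧ ℓ ≤ L ∧ IsLogPath f N ℓ γ θ ∧ γ 0 = γ ℓ ∧ θ 0 ≠ θ ℓ ∧
      InjOn γ (Ico 0 ℓ) := by
  have hL : 0 ≤ L := by
    obtain ⟨_, _, p, _⟩ := h
    exact p.nonneg
  let A : Set (BoundedContinuousFunction unitInterval Z) :=
    {α | ∀ s t, dist (α s) (α t) ≤ L * dist s t}
  have hA : IsCompact A := by
    refine BoundedContinuousFunction.arzela_ascoli₁ A ?_ ?_
    · simp only [A, ofPred_forall]
      exact isClosed_iInter fun s ↦ isClosed_iInter fun t ↦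
        isClosed_le (by fun_prop) continuous_const
    · refine LipschitzWith.uniformEquicontinuous _ L.toNNReal (fun α ↦ ?_) |>.equicontinuous
      refine LipschitzWith.of_dist_le_mul fun s t ↦ ?_
      rw [Real.coe_toNNReal _ hL]
      exact α.2 s t
  let Q : Set (ℝ × BoundedContinuousFunction unitInterval Z) :=
    (Icc 0 L ×ˢ A) ∩ ({q | ∀ s t, dist (q.2 s) (q.2 t) ≤ q.1 * dist s t} ∩
      Prod.snd ⁻¹' essentialLoops f N)
  have hQ : IsCompact Q := by
    refine (isCompact_Icc.prod hA).inter_right (IsClosed.inter ?_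
      ((isClosed_essentialLoops hf hN hfN).preimage continuous_snd))
    simp only [ofPred_forall]
    exact isClosed_iInter fun s ↦ isClosed_iInter fun t ↦
      isClosed_le (by fun_prop) (by fun_prop)
  have hmemQ : ∀ {a : Z} {ℓ : ℝ} {w : ℂ}, LogPath f N a a ℓ w → w ≠ 0 → ℓ ≤ L →
      ∃ α, (ℓ, α) ∈ Q := by
    intro a ℓ w hp hw hℓ
    have h0 : 0 ≤ ℓ := by
      obtain ⟨_, _, p, _⟩ := hp
      exact p.nonneg
    obtain ⟨α, hα, hlip⟩ := hp.exists_essentialLoop hw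
    exact ⟨α, ⟨⟨h0, hℓ⟩, fun s t ↦ (hlip s t).trans (by gcongr)⟩, hlip, hα⟩
  obtain ⟨α₀, hα₀⟩ := hmemQ h hw le_rfl
  obtain ⟨⟨ℓ, α⟩, hα, hmin⟩ := hQ.exists_isMinOn ⟨_, hα₀⟩ continuous_fst.continuousOn
  obtain ⟨hpos, γ, θ, p, h01, hne⟩ :=
    exists_isLogPath_of_mem_essentialLoops hα.2.2 hα.1.1.1 hα.2.1
  refine ⟨ℓ, γ, θ, hpos, hα.1.1.2, p, h01, hne, ?_⟩
  have key : ∀ s ∈ Ico 0 ℓ, ∀ t ∈ Ico 0 ℓ, s < t → γ s ≠ γ t := by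
    intro s hs t ht hst heq
    have inner := p.logPath_sub hs.1 hst.le ht.2.le
    have outer := (p.logPath_sub le_rfl hs.1 hs.2.le).trans
      (heq ▸ p.logPath_sub ht.1 ht.2.le le_rfl)
    rw [heq] at inner
    rw [h01] at outer
    have hle : ∀ {b : Z} {m : ℝ} {v : ℂ}, LogPath f N b b m v → v ≠ 0 → m ≤ L → ℓ ≤ m := by
      intro b m v hp hv hm
      obtain ⟨β, hβ⟩ := hmemQ hp hv hm
      exact hmin hβ
    have hℓL := hα.1.1.2
    by_cases hv : θ t - θ s = 0
    · have := hle outer (fun h0 ↦ hne ?_) (by linarith [hs.1, ht.2])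
      · linarith
      · linear_combination -h0 - hv
    · have := hle inner hv (by linarith [hs.1, ht.2])
      linarith [hs.1, ht.2]
  intro s hs t ht heq
  rcases lt_trichotomy s t with h | h | h
  · exact absurd heq (key s hs t ht h)
  · exact h
  · exact absurd heq.symm (key t ht s hs h)

end

section

/-- The sum of a cocycle along a walk. -/
def SimpleGraph.Walk.cocycleSum {ι : Type*} {G : SimpleGraph ι} (c : ι → ι → ℂ) :
    ∀ {u v : ι}, G.Walk u v → ℂ
  | _, _, .nil => 0
  | u, _, .cons (v := v) _ p => c u v + p.cocycleSum c

theorem SimpleGraph.Walk.cocycleSum_append {ι : Type*} {G : SimpleGraph ι} (c : ι → ι → ℂ)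
    {u v w : ι} (p : G.Walk u v) (q : G.Walk v w) :
    (p.append q).cocycleSum c = p.cocycleSum c + q.cocycleSum c := by
  induction p with
  | nil => simp [cocycleSum]
  | cons h p ih => simp [cocycleSum, ih, add_assoc]

theorem SimpleGraph.Walk.cocycleSum_reverse {ι : Type*} {G : SimpleGraph ι} {c : ι → ι → ℂ}
    (hc : ∀ i j, c j i = - c i j) {u v : ι} (p : G.Walk u v) :
    p.reverse.cocycleSum c = - p.cocycleSum c := by
  induction p with
  | nil => simp [cocycleSum]
  | cons h p ih =>
    rw [reverse_cons, cocycleSum_append, ih]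
    simp only [cocycleSum]
    rw [hc]
    ring

/-- A cocycle on a graph which sums to zero along simple cycles is a coboundary. -/
theorem SimpleGraph.exists_potential {ι : Type*} {G : SimpleGraph ι} {c : ι → ι → ℂ}
    (hc : ∀ i j, c j i = - c i j)
    (h : ∀ u v, G.Adj u v → ∀ p : G.Walk v u, p.IsPath → c u v + p.cocycleSum c = 0) :
    ∃ n : ι → ℂ, (∀ i j, G.Adj i j → n j = n i + c i j) ∧
      ∀ i, ∃ j, ∃ p : G.Walk j i, n i = p.cocycleSum c := by
  classical
  have hbypass : ∀ {u v} (p : G.Walk u v), p.bypass.cocycleSum c = p.cocycleSum c := by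
    intro u v p
    induction p with
    | nil => rfl
    | @cons u v w huv p ih =>
      simp only [Walk.bypass]
      split_ifs with hs
      · have e := Walk.cocycleSum_append c (p.bypass.takeUntil u hs) (p.bypass.dropUntil u hs)
        rw [Walk.take_spec, ih] at e
        have e' := h u v huv _ ((Walk.bypass_isPath p).takeUntil hs)
        simp only [Walk.cocycleSum]
        linear_combination -e' - e
      · simp only [Walk.cocycleSum, ih]
  have hclosed : ∀ {u} (p : G.Walk u u), p.cocycleSum c = 0 := by
    intro u p
    rw [← hbypass p, (Walk.isPath_iff_nil.1 p.bypass_isPath).eq_nil]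
    rfl
  let root : ι → ι := fun i ↦ (G.connectedComponentMk i).out
  have hroot : ∀ i, Nonempty (G.Walk (root i) i) := fun i ↦
    ConnectedComponent.exact (G.connectedComponentMk i).out_eq
  refine ⟨fun i ↦ (hroot i).some.cocycleSum c, fun i j hij ↦ ?_, fun i ↦ ⟨_, _, rfl⟩⟩
  have hr : root i = root j := by
    simp only [root]
    rw [ConnectedComponent.connectedComponentMk_eq_of_adj hij]
  have := hclosed ((((hroot i).some.copy hr rfl).append (.cons hij .nil)).append
    (hroot j).some.reverse)
  have hcopy : ∀ {r r' s : ι} (e : r = r') (p : G.Walk r s),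
      (p.copy e rfl).cocycleSum c = p.cocycleSum c := by
    rintro r _ s rfl p
    rfl
  rw [Walk.cocycleSum_append, Walk.cocycleSum_append, Walk.cocycleSum_reverse hc, hcopy] at this
  simp only [Walk.cocycleSum] at this
  linear_combination -this

end

/-- A compact set has finite open covers of small mesh which almost realize its `μH[1]` measure. -/
theorem exists_finset_open_cover {Z : Type*} [MetricSpace Z] [MeasurableSpace Z] [BorelSpace Z]
    {K : Set Z} (hK : IsCompact K) {L : ℝ} (hL : μH[1] K < ENNReal.ofReal L) {δ : ℝ}
    (hδ : 0 < δ) : ∃ (F : Finset ℕ) (E : ℕ → Set Z), (∀ i, IsOpen (E i)) ∧ K ⊆ ⋃ i ∈ F, E i ∧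
      (∀ i ∈ F, (E i ∩ K).Nonempty) ∧ (∀ i, ∀ x ∈ E i, ∀ y ∈ E i, dist x y ≤ δ) ∧
      (∀ i, 0 ≤ diam (E i)) ∧ (∀ i, ∀ x ∈ E i, ∀ y ∈ E i, dist x y ≤ diam (E i)) ∧
      ∑ i ∈ F, diam (E i) ≤ L := by
  classical
  have hL0 : 0 < L := by
    by_contra! h
    simp [ENNReal.ofReal_eq_zero.2 h] at hL
  rw [Measure.hausdorffMeasure_apply] at hL
  have h1 := (le_iSup₂ (f := fun (r : ℝ≥0∞) (_ : 0 < r) ↦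
    ⨅ (t : ℕ → Set Z) (_ : K ⊆ ⋃ n, t n) (_ : ∀ n, ediam (t n) ≤ r),
          ∑' n, ⨆ _ : (t n).Nonempty, ediam (t n) ^ (1 : ℝ)) (ENNReal.ofReal (δ / 2))
    (by simpa using hδ)).trans_lt hL
  simp only [iInf_lt_iff] at h1
  obtain ⟨t, hKt, htd, hsum⟩ := h1
  have hd : ∀ s : Set Z, (⨆ _ : s.Nonempty, ediam s ^ (1 : ℝ)) = ediam s := by
    intro s
    rcases s.eq_empty_or_nonempty with rfl | hs
    · simp
    · simp [hs]
  simp only [hd] at hsum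
  obtain ⟨η, hη0, hη⟩ := ENNReal.exists_pos_sum_of_countable
    (tsub_pos_of_lt hsum).ne' ℕ
  let ρ : ℕ → NNReal := fun n ↦ min (η n / 2) (δ / 4).toNNReal
  have hρ : ∀ n, 0 < ρ n := fun n ↦ lt_min (half_pos (hη0 n)) (by simpa using hδ)
  let E : ℕ → Set Z := fun n ↦ thickening (ρ n) (t n)
  have hEd : ∀ n, ediam (E n) ≤ ediam (t n) + η n := fun n ↦ by
    refine (ediam_thickening_le _).trans ?_
    gcongr
    calc (2 : ℝ≥0∞) * ρ n ≤ 2 * (η n / 2 : NNReal) := by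
          gcongr
          exact min_le_left _ _
      _ = ((2 * (η n / 2) : NNReal) : ℝ≥0∞) := by push_cast; rfl
      _ = η n := by rw [mul_div_cancel₀ _ two_ne_zero]
  have hEδ : ∀ n, ediam (E n) ≤ ENNReal.ofReal δ := fun n ↦ by
    refine (ediam_thickening_le _).trans ?_
    calc ediam (t n) + 2 * (ρ n : ℝ≥0∞)
        ≤ ENNReal.ofReal (δ / 2) + 2 * ((δ / 4).toNNReal : NNReal) := by
          gcongr
          · exact htd n
          · exact min_le_right _ _
      _ = ENNReal.ofReal (δ / 2) + ENNReal.ofReal 2 * ENNReal.ofReal (δ / 4) := by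
          simp [ENNReal.ofReal]
      _ = ENNReal.ofReal δ := by
          rw [← ENNReal.ofReal_mul (by norm_num), ← ENNReal.ofReal_add (by positivity)
            (by positivity)]
          congr 1
          ring
  have hEfin : ∀ n, ediam (E n) ≠ ⊤ := fun n ↦ ((hEδ n).trans_lt ENNReal.ofReal_lt_top).ne
  have hEo : ∀ n, IsOpen (E n) := fun n ↦ isOpen_thickening
  obtain ⟨F, hF⟩ := hK.elim_finite_subcover E hEo (hKt.trans
    (iUnion_mono fun n ↦ self_subset_thickening (by exact_mod_cast hρ n) _))
  have hdist : ∀ i, ∀ x ∈ E i, ∀ y ∈ E i, dist x y ≤ diam (E i) := fun i x hx y hy ↦ by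
    rw [dist_edist]
    exact ENNReal.toReal_mono (hEfin i) (edist_le_ediam_of_mem hx hy)
  refine ⟨F.filter fun i ↦ (E i ∩ K).Nonempty, E, hEo, fun x hx ↦ ?_,
    fun i hi ↦ (Finset.mem_filter.1 hi).2, fun i x hx y hy ↦ ?_, fun i ↦ diam_nonneg, hdist, ?_⟩
  · obtain ⟨i, hi, hxi⟩ := mem_iUnion₂.1 (hF hx)
    exact mem_iUnion₂.2 ⟨i, Finset.mem_filter.2 ⟨hi, x, hxi, hx⟩, hxi⟩
  · refine (hdist i x hx y hy).trans ?_
    exact ENNReal.toReal_le_of_le_ofReal hδ.le (hEδ i)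
  · have : ENNReal.ofReal (∑ i ∈ F.filter fun i ↦ (E i ∩ K).Nonempty, diam (E i)) ≤
        ENNReal.ofReal L := by
      rw [ENNReal.ofReal_sum_of_nonneg fun i _ ↦ diam_nonneg]
      calc ∑ i ∈ F.filter fun i ↦ (E i ∩ K).Nonempty, ENNReal.ofReal (diam (E i))
          = ∑ i ∈ F.filter fun i ↦ (E i ∩ K).Nonempty, ediam (E i) :=
            Finset.sum_congr rfl fun i _ ↦ ENNReal.ofReal_toReal (hEfin i)
        _ ≤ ∑' i, ediam (E i) := ENNReal.sum_le_tsum _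
        _ ≤ ∑' i, (ediam (t i) + η i) := ENNReal.tsum_le_tsum hEd
        _ = ∑' i, ediam (t i) + ∑' i, (η i : ℝ≥0∞) := ENNReal.tsum_add
        _ ≤ ∑' i, ediam (t i) + (ENNReal.ofReal L - ∑' i, ediam (t i)) := by gcongr
        _ = ENNReal.ofReal L := add_tsub_cancel_of_le hsum.le
    exact (ENNReal.ofReal_le_ofReal_iff hL0.le).1 this

theorem IsGeodesicSpace.isPreconnected_ball {Z : Type*} [MetricSpace Z] (h : IsGeodesicSpace Z)
    (x : Z) (r : ℝ) : IsPreconnected (ball x r) := by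
  refine isPreconnected_of_forall x fun y hy ↦ ?_
  obtain ⟨γ, h0, h1, hγ⟩ := h x y
  have hd : (0 : ℝ) ≤ dist x y := dist_nonneg
  have hc : ContinuousOn γ (Icc 0 (dist x y)) :=
    LipschitzOnWith.continuousOn (K := 1) (LipschitzOnWith.of_dist_le_mul fun s hs t ht ↦ by
      simp [hγ s hs t ht, Real.dist_eq])
  refine ⟨γ '' Icc 0 (dist x y), ?_, ⟨0, ⟨le_rfl, hd⟩, h0⟩, ⟨_, ⟨hd, le_rfl⟩, h1⟩,
    isPreconnected_Icc.image γ hc⟩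
  rintro _ ⟨s, hs, rfl⟩
  have := hγ s hs 0 ⟨le_rfl, hd⟩
  rw [h0, sub_zero, abs_of_nonneg hs.1] at this
  rw [mem_ball, this]
  exact hs.2.trans_lt (by rwa [mem_ball, dist_comm] at hy)

theorem IsGeodesicSpace.logPath {Z : Type*} [MetricSpace Z] (h : IsGeodesicSpace Z) {f g : Z → ℂ}
    {N V : Set Z} {a b : Z} (hV : closedBall a (dist a b) ⊆ V) (hVN : V ⊆ N)
    (hg : ContinuousOn g V) (hgf : ∀ x ∈ V, Complex.exp (g x) = f x) :
    LogPath f N a b (dist a b) (g b - g a) := by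
  obtain ⟨γ, h0, h1, hγ⟩ := h a b
  have hd : (0 : ℝ) ≤ dist a b := dist_nonneg
  have hc : ContinuousOn γ (Icc 0 (dist a b)) :=
    LipschitzOnWith.continuousOn (K := 1) (LipschitzOnWith.of_dist_le_mul fun s hs t ht ↦ by
      simp [hγ s hs t ht, Real.dist_eq])
  have hm : MapsTo γ (Icc 0 (dist a b)) V := fun s hs ↦ hV <| by
    have := hγ s hs 0 ⟨le_rfl, hd⟩
    rw [h0, sub_zero, abs_of_nonneg hs.1] at this
    rw [mem_closedBall, this]
    exact hs.2
  exact ⟨γ, g ∘ γ, ⟨hd, fun s hs t ht ↦ (hγ s hs t ht).le, fun s hs ↦ hVN (hm hs),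
    hg.comp hc hm, fun s hs ↦ hgf _ (hm hs)⟩, h0, h1, by simp [h0, h1]⟩

/-- If `f` has no logarithm on a compact set `K`, then there is a loop near `K`, of length at most
any number exceeding `μH[1] K`, along which logarithms of `f` are multivalued. -/
theorem IsGeodesicSpace.exists_logPath {Z : Type*} [MetricSpace Z] [CompactSpace Z]
    [MeasurableSpace Z] [BorelSpace Z] (h : IsGeodesicSpace Z) {f : Z → ℂ} (hf : Continuous f)
    {K N : Set Z} (hK : IsCompact K) {ε : ℝ} (hε : 0 < ε) (hKN : ∀ x ∈ K, ball x ε ⊆ N)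
    {c₀ : ℝ} (hc₀ : 0 < c₀) (hfN : ∀ x ∈ N, c₀ ≤ ‖f x‖) (hlog : ¬ HasLogOn f K)
    {L : ℝ} (hL : μH[1] K < ENNReal.ofReal L) :
    ∃ a ℓ w, w ≠ 0 ∧ ℓ ≤ L ∧ LogPath f N a a ℓ w := by
  classical
  obtain ⟨η, hη, hηf⟩ := Metric.uniformContinuous_iff.1
    (CompactSpace.uniformContinuous_of_continuous hf) c₀ hc₀
  obtain ⟨δ, hδ, hδε, hδη⟩ : ∃ δ > 0, 3 * δ ≤ ε ∧ 3 * δ ≤ η :=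
    ⟨min ε η / 3, by positivity, by linarith [min_le_left ε η], by linarith [min_le_right ε η]⟩
  obtain ⟨F, E, hEo, hKE, hEK, hEδ, hE0, hEd, hsum⟩ := exists_finset_open_cover hK hL hδ
  obtain ⟨x₀, hx₀⟩ : K.Nonempty := by
    by_contra hK0
    rw [not_nonempty_iff_eq_empty] at hK0
    exact hlog ⟨0, by simp [hK0], by simp [hK0]⟩
  have : Nonempty Z := ⟨x₀⟩
  choose! x hx using hEK
  let V : ℕ → Set Z := fun i ↦ ball (x i) (3 * δ)
  have hVN : ∀ i ∈ F, V i ⊆ N := fun i hi ↦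
    (ball_subset_ball hδε).trans (hKN _ (hx i hi).2)
  have hEV : ∀ i ∈ F, ∀ y ∈ E i, ball y (2 * δ) ⊆ V i := fun i hi y hy ↦ by
    refine ball_subset_ball' ?_
    linarith [hEδ i y hy (x i) (hx i hi).1]
  let g : ℕ → Z → ℂ := fun i y ↦ Complex.log (f y / f (x i)) + Complex.log (f (x i))
  have hlt : ∀ i ∈ F, ∀ y ∈ V i, ‖f y - f (x i)‖ < ‖f (x i)‖ := fun i hi y hy ↦ by
    rw [← dist_eq_norm]
    exact (hηf ((mem_ball.1 hy).trans_le hδη)).trans_le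
      (hfN _ (hVN i hi (mem_ball_self (by positivity))))
  have hgc : ∀ i ∈ F, ContinuousOn (g i) (V i) := fun i hi ↦
    (continuousOn_log_div continuousOn_const hf.continuousOn (hlt i hi)).add continuousOn_const
  have hge : ∀ i ∈ F, ∀ y ∈ V i, Complex.exp (g i y) = f y := fun i hi y hy ↦ by
    have h0 : f (x i) ≠ 0 := norm_pos_iff.1 ((norm_nonneg _).trans_lt (hlt i hi y hy))
    rw [Complex.exp_add, exp_log_div (hlt i hi y hy), Complex.exp_log h0, div_mul_cancel₀ _ h0]
  have hgconst : ∀ i ∈ F, ∀ j ∈ F, ∀ y ∈ E i ∩ E j, ∀ z ∈ E i ∩ E j,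
      g i y - g j y = g i z - g j z := fun i hi j hj y hy z hz ↦ by
    have hi' := hEV i hi y hy.1
    have hj' := hEV j hj y hy.2
    refine sub_eq_sub_of_exp_eq (h.isPreconnected_ball y (2 * δ)) ((hgc i hi).mono hi')
      ((hgc j hj).mono hj') (fun u hu ↦ ?_) (mem_ball_self (by positivity)) ?_
    · rw [hge i hi u (hi' hu), hge j hj u (hj' hu)]
    · rw [mem_ball]
      linarith [hEδ i z hz.1 y hy.1]
  let G : SimpleGraph F :=
    { Adj := fun i j ↦ i ≠ j ∧ (E i ∩ E j).Nonempty
      symm := ⟨fun i j hij ↦ ⟨hij.1.symm, by rw [inter_comm]; exact hij.2⟩⟩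
      loopless := ⟨fun i hi ↦ hi.1 rfl⟩ }
  let c : F → F → ℂ := fun i j ↦
    if hij : (E i ∩ E j).Nonempty then g i hij.some - g j hij.some else 0
  have hcE : ∀ (i j : F), ∀ y ∈ E i ∩ E j, c i j = g i y - g j y := fun i j y hy ↦ by
    have hij : (E i ∩ E j).Nonempty := ⟨y, hy⟩
    simp only [c, hij, dif_pos]
    exact hgconst i i.2 j j.2 _ hij.some_mem y hy
  have hanti : ∀ i j, c j i = - c i j := fun i j ↦ by
    by_cases hij : (E i ∩ E j).Nonempty
    · obtain ⟨y, hy⟩ := hij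
      rw [hcE i j y hy, hcE j i y hy.symm, neg_sub]
    · have hji : ¬ (E j ∩ E i).Nonempty := by rwa [inter_comm]
      simp [c, hij, hji]
  have hstep : ∀ (i : F), ∀ a ∈ E i, ∀ b ∈ E i, LogPath f N a b (dist a b) (g i b - g i a) :=
    fun i a ha b hb ↦ by
      refine h.logPath ((closedBall_subset_ball ?_).trans (hEV i i.2 a ha)) (hVN i i.2)
        (hgc i i.2) (hge i i.2)
      linarith [hEδ i a ha b hb]
  have hwalk : ∀ {u v : F} (p : G.Walk u v), ∀ a ∈ E u, ∀ b ∈ E v,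
      ∃ ℓ ≤ (p.support.map fun i : F ↦ diam (E i)).sum,
        LogPath f N a b ℓ (g v b + p.cocycleSum c - g u a) := by
    intro u v p
    induction p with
    | @nil u =>
      intro a ha b hb
      refine ⟨dist a b, by simpa using hEd u a ha b hb, ?_⟩
      simpa [SimpleGraph.Walk.cocycleSum] using hstep u a ha b hb
    | @cons u w v huw p ih =>
      intro a ha b hb
      obtain ⟨y, hy⟩ := huw.2
      obtain ⟨ℓ, hℓ, hp⟩ := ih y hy.2 b hb
      refine ⟨dist a y + ℓ, ?_, ?_⟩
      · simpa using add_le_add (hEd u a ha y hy.1) hℓ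
      · have := (hstep u a ha y hy.1).trans hp
        convert this using 1
        simp only [SimpleGraph.Walk.cocycleSum, hcE u w y hy]
        ring
  by_contra! hcon
  refine hlog ?_
  obtain ⟨n, hn, hnp⟩ := SimpleGraph.exists_potential (G := G) hanti fun u v huv p hp ↦ by
    obtain ⟨y, hy⟩ := huv.2
    obtain ⟨ℓ, hℓ, hpath⟩ := hwalk p y hy.2 y hy.1
    by_contra hne
    refine hcon y ℓ _ ?_ ?_ hpath
    · rw [hcE u v y hy] at hne
      intro h0
      exact hne (by linear_combination h0)
    · refine hℓ.trans (le_trans ?_ hsum)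
      rw [← List.sum_toFinset _ hp.support_nodup, ← Finset.sum_coe_sort F]
      exact Finset.sum_le_sum_of_subset_of_nonneg (Finset.subset_univ _) fun i _ _ ↦ hE0 i
  have hexp : ∀ {u v : F} (p : G.Walk u v), Complex.exp (p.cocycleSum c) = 1 := by
    intro u v p
    induction p with
    | nil => simp [SimpleGraph.Walk.cocycleSum]
    | @cons u w v huw p ih =>
      obtain ⟨y, hy⟩ := huw.2
      have hu := hEV u u.2 y hy.1 (mem_ball_self (by positivity))
      have hw := hEV w w.2 y hy.2 (mem_ball_self (by positivity))
      rw [SimpleGraph.Walk.cocycleSum, Complex.exp_add, ih, hcE u w y hy, Complex.exp_sub,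
        hge u u.2 y hu, hge w w.2 y hw, mul_one, div_self]
      rw [← hge u u.2 y hu]
      exact Complex.exp_ne_zero _
  have hcov : ∀ y, ∃ i : F, y ∈ K → y ∈ E i := fun y ↦ by
    by_cases hy : y ∈ K
    · obtain ⟨i, hi, hyi⟩ := mem_iUnion₂.1 (hKE hy)
      exact ⟨⟨i, hi⟩, fun _ ↦ hyi⟩
    · obtain ⟨i, hi, -⟩ := mem_iUnion₂.1 (hKE hx₀)
      exact ⟨⟨i, hi⟩, fun h ↦ absurd h hy⟩
  choose ι hι using hcov
  have hglue : ∀ (i : F), ∀ y ∈ K, y ∈ E i → g (ι y) y + n (ι y) = g i y + n i :=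
    fun i y hy hyi ↦ by
      by_cases hij : i = ι y
      · rw [← hij]
      · have hy' : y ∈ E i ∩ E (ι y) := ⟨hyi, hι y hy⟩
        rw [hn i (ι y) ⟨hij, y, hy'⟩, hcE i (ι y) y hy']
        ring
  have hself : ∀ (i : F), ∀ y ∈ E i, y ∈ V i := fun i y hy ↦
    hEV i i.2 y hy (mem_ball_self (by positivity))
  refine ⟨fun y ↦ g (ι y) y + n (ι y), fun y hy ↦ ?_, fun y hy ↦ ?_⟩
  · have hyE := hι y hy
    have hcont : ContinuousWithinAt (fun z ↦ g (ι y) z + n (ι y)) K y :=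
      (((hgc _ (ι y).2).continuousAt (isOpen_ball.mem_nhds (hself _ y hyE))).add
        continuousAt_const).continuousWithinAt
    refine hcont.congr_of_eventuallyEq ?_ rfl
    filter_upwards [self_mem_nhdsWithin, mem_nhdsWithin_of_mem_nhds ((hEo (ι y)).mem_nhds hyE)]
      with z hz hzE using hglue _ z hz hzE
  · obtain ⟨j, p, hp⟩ := hnp (ι y)
    rw [Complex.exp_add, hp, hexp, mul_one, hge _ (ι y).2 y (hself _ y (hι y hy))]

/-- A function on a compact set which is constant on the fibers of a continuous map descends to a
continuous function on the image. -/
theorem IsCompact.exists_continuousOn_image {X Y : Type*} [TopologicalSpace X]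
    [TopologicalSpace Y] [T2Space Y] {S : Set X} (hS : IsCompact S) {γ : X → Y}
    (hγ : ContinuousOn γ S) {h : X → ℂ} (hh : ContinuousOn h S)
    (hfib : ∀ s ∈ S, ∀ t ∈ S, γ s = γ t → h s = h t) :
    ∃ g : Y → ℂ, ContinuousOn g (γ '' S) ∧ ∀ s ∈ S, g (γ s) = h s := by
  classical
  let g : Y → ℂ := fun y ↦ if hy : y ∈ γ '' S then h hy.choose else 0
  have hg : ∀ s ∈ S, g (γ s) = h s := fun s hs ↦ by
    have hy : γ s ∈ γ '' S := mem_image_of_mem γ hs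
    simp only [g, hy, dif_pos]
    exact hfib _ hy.choose_spec.1 _ hs hy.choose_spec.2
  refine ⟨g, continuousOn_iff_isClosed.2 fun t ht ↦ ⟨γ '' (S ∩ h ⁻¹' t), ?_, ?_⟩, hg⟩
  · have hcl : IsCompact (S ∩ h ⁻¹' t) := by
      obtain ⟨u, hu, hut⟩ := continuousOn_iff_isClosed.1 hh t ht
      rw [inter_comm, hut, inter_comm]
      exact hS.inter_right hu
    exact (hcl.image_of_continuousOn (hγ.mono inter_subset_left)).isClosed
  · ext y
    constructor
    · rintro ⟨hy, s, hs, rfl⟩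
      exact ⟨⟨s, ⟨hs, by rwa [mem_preimage, ← hg s hs]⟩, rfl⟩, s, hs, rfl⟩
    · rintro ⟨⟨s, ⟨hs, hst⟩, rfl⟩, -⟩
      exact ⟨by rwa [mem_preimage, hg s hs], s, hs, rfl⟩

/-- A simple closed path traces a Jordan curve. -/
theorem nonempty_homeomorph_circle {Z : Type*} [TopologicalSpace Z] [T2Space Z] {ℓ : ℝ}
    (hℓ : 0 < ℓ) {γ : ℝ → Z} (hγ : ContinuousOn γ (Icc 0 ℓ)) (h0 : γ 0 = γ ℓ)
    (hinj : InjOn γ (Ico 0 ℓ)) : Nonempty (↥(γ '' Icc 0 ℓ) ≃ₜ Circle) := by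
  have : Fact (0 < ℓ) := ⟨hℓ⟩
  let β : AddCircle ℓ → Z := AddCircle.liftIco ℓ 0 γ
  have hβc : Continuous β := AddCircle.liftIco_zero_continuous h0 hγ
  have hβ : ∀ t ∈ Ico 0 ℓ, β (t : AddCircle ℓ) = γ t := fun t ht ↦
    AddCircle.liftIco_zero_coe_apply ht
  have hrep : ∀ x : AddCircle ℓ, ∃ t ∈ Ico 0 ℓ, (t : AddCircle ℓ) = x := fun x ↦ by
    have := AddCircle.coe_image_Ico_eq ℓ 0
    rw [zero_add] at this
    have hx : x ∈ ((↑) : ℝ → AddCircle ℓ) '' Ico 0 ℓ := this ▸ mem_univ x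
    exact hx
  have hβi : Function.Injective β := by
    intro x y hxy
    obtain ⟨s, hs, rfl⟩ := hrep x
    obtain ⟨t, ht, rfl⟩ := hrep y
    rw [hβ s hs, hβ t ht] at hxy
    rw [hinj hs ht hxy]
  have hrange : range β = γ '' Icc 0 ℓ := by
    ext z
    constructor
    · rintro ⟨x, rfl⟩
      obtain ⟨s, hs, rfl⟩ := hrep x
      exact ⟨s, Ico_subset_Icc_self hs, (hβ s hs).symm⟩
    · rintro ⟨s, hs, rfl⟩
      rcases hs.2.eq_or_lt with rfl | hlt
      · exact ⟨((0 : ℝ) : AddCircle s), by rw [hβ 0 ⟨le_rfl, hℓ⟩, h0]⟩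
      · exact ⟨(s : AddCircle ℓ), hβ s ⟨hs.1, hlt⟩⟩
  have hemb : Topology.IsClosedEmbedding β := hβc.isClosedEmbedding hβi
  exact ⟨(Homeomorph.setCongr hrange.symm).trans
    (hemb.isEmbedding.toHomeomorph.symm.trans (AddCircle.homeomorphCircle hℓ.ne'))⟩

section

variable {Z : Type*} [MetricSpace Z] {f : Z → ℂ} {N : Set Z}

theorem IsLogPath.not_hasLogOn_image {ℓ : ℝ} {γ : ℝ → Z} {θ : ℝ → ℂ} (p : IsLogPath f N ℓ γ θ)
    (h0 : γ 0 = γ ℓ) (hne : θ 0 ≠ θ ℓ) : ¬ HasLogOn f (γ '' Icc 0 ℓ) := by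
  rintro ⟨g, hg, hgf⟩
  have := sub_eq_sub_of_exp_eq isPreconnected_Icc p.continuousOn
    (hg.comp p.lipschitzOnWith.continuousOn (mapsTo_image γ _))
    (fun t ht ↦ by rw [p.exp_eq t ht]; exact (hgf _ (mem_image_of_mem γ ht)).symm)
    (left_mem_Icc.2 p.nonneg) (right_mem_Icc.2 p.nonneg)
  simp only [Function.comp, h0, sub_left_inj] at this
  exact hne this

/-- A logarithm exists on every proper closed subset of a Jordan curve. -/
theorem IsLogPath.hasLogOn_of_notMem {ℓ : ℝ} {γ : ℝ → Z} {θ : ℝ → ℂ} (p : IsLogPath f N ℓ γ θ)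
    (h0 : γ 0 = γ ℓ) (hinj : InjOn γ (Ico 0 ℓ)) {A : Set Z} (hA : IsClosed A)
    (hAT : A ⊆ γ '' Icc 0 ℓ) {t₀ : ℝ} (ht₀ : t₀ ∈ Ico 0 ℓ) (hAt₀ : γ t₀ ∉ A) : HasLogOn f A := by
  have hγ := p.lipschitzOnWith.continuousOn
  set S : Set ℝ := Icc 0 ℓ ∩ γ ⁻¹' A with hS
  have hScpt : IsCompact S := by
    obtain ⟨u, hu, hut⟩ := continuousOn_iff_isClosed.1 hγ A hA
    rw [hS, inter_comm, hut, inter_comm]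
    exact isCompact_Icc.inter_right hu
  have hSA : γ '' S = A := by
    rw [hS, image_inter_preimage, inter_eq_right.2 hAT]
  have hSt : ∀ s ∈ S, s ≠ t₀ := by
    rintro s hs rfl
    exact hAt₀ hs.2
  let h : ℝ → ℂ := fun t ↦ if t < t₀ then θ t else θ t - (θ ℓ - θ 0)
  have hexp0 : Complex.exp (θ ℓ - θ 0) = 1 := by
    rw [Complex.exp_sub, p.exp_eq ℓ (right_mem_Icc.2 p.nonneg), ← h0,
      ← p.exp_eq 0 (left_mem_Icc.2 p.nonneg), div_self (Complex.exp_ne_zero _)]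
  have hhc : ContinuousOn h S := by
    have hθS : ContinuousOn θ S := p.continuousOn.mono inter_subset_left
    intro s hs
    rcases (hSt s hs).lt_or_gt with hlt | hgt
    · refine (hθS s hs).congr_of_eventuallyEq ?_ (by simp [h, hlt])
      filter_upwards [mem_nhdsWithin_of_mem_nhds (Iio_mem_nhds hlt)] with t ht
      simp [h, mem_Iio.1 ht]
    · refine ((hθS s hs).sub continuousWithinAt_const).congr_of_eventuallyEq ?_
        (by simp [h, hgt.not_gt]; rfl)
      filter_upwards [mem_nhdsWithin_of_mem_nhds (Ioi_mem_nhds hgt)] with t ht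
      simp [h, (mem_Ioi.1 ht).not_gt]
  have hfib : ∀ s ∈ S, ∀ t ∈ S, s < t → γ s = γ t → h s = h t := by
    intro s hs t ht hst heq
    have hs' : s ∈ Ico 0 ℓ := ⟨hs.1.1, hst.trans_le ht.1.2⟩
    rcases ht.1.2.eq_or_lt with rfl | htl
    · have hs0 : s = 0 := hinj hs' ⟨le_rfl, ht₀.1.trans_lt ht₀.2⟩ (heq.trans h0.symm)
      subst hs0
      have : 0 < t₀ := lt_of_le_of_ne ht₀.1 (hSt 0 hs)
      simp [h, this, ht₀.2.not_gt]
    · exact absurd (hinj hs' ⟨ht.1.1, htl⟩ heq) hst.ne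
  obtain ⟨g, hg, hgh⟩ := hScpt.exists_continuousOn_image (hγ.mono inter_subset_left) hhc
    fun s hs t ht heq ↦ by
      rcases lt_trichotomy s t with hst | rfl | hst
      · exact hfib s hs t ht hst heq
      · rfl
      · exact (hfib t ht s hs hst heq.symm).symm
  rw [hSA] at hg
  refine ⟨g, hg, fun z hz ↦ ?_⟩
  obtain ⟨s, hs, rfl⟩ := hSA.symm ▸ hz
  rw [hgh s hs, ← p.exp_eq s hs.1]
  by_cases hlt : s < t₀
  · simp [h, hlt]
  · simp only [h, hlt, if_false]
    rw [Complex.exp_sub, hexp0, div_one]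

end

theorem not_hasLogOn_frontier_of_isClosedEmbedding {Z : Type*} [TopologicalSpace Z]
    [CompactSpace Z] {e : Z → ℂ} (he : Topology.IsClosedEmbedding e) {Ω : Set Z} (hΩ : IsOpen Ω)
    (heΩ : IsOpen (e '' Ω)) {z₀ : Z} (hz₀ : z₀ ∈ Ω) :
    ¬ HasLogOn (fun z ↦ e z - e z₀) (frontier Ω) := by
  rintro ⟨g, hg, hgf⟩
  obtain ⟨k, hk, hkg⟩ := (isClosed_frontier (s := Ω)).isCompact.exists_continuousOn_image
    he.continuous.continuousOn hg fun s _ t _ hst ↦ by rw [he.injective hst]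
  have hb : Bornology.IsBounded (e '' Ω) :=
    ((isCompact_range he.continuous).isBounded).subset (image_subset_range e Ω)
  refine not_hasLogOn_frontier hb (mem_image_of_mem e hz₀) ⟨k, ?_⟩
  have hsub : frontier (e '' Ω) ⊆ e '' frontier Ω := by
    rw [heΩ.frontier_eq, hΩ.frontier_eq, image_sdiff he.injective, he.closure_image_eq]
  refine ⟨hk.mono hsub, fun w hw ↦ ?_⟩
  obtain ⟨z, hz, rfl⟩ := hsub hw
  rw [hkg z hz, hgf z hz]

/-- A space homeomorphic to the closed square embeds in the plane such that open sets missing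
the boundary have open image and the image is supported by a line at each boundary point. -/
theorem exists_planar_embedding {Z : Type*} [TopologicalSpace Z]
    (φ : Z ≃ₜ ↥(closedBall (0 : ℝ × ℝ) 1)) [CompactSpace Z] {bdry : Set Z}
    (hbdry : bdry = {z : Z | (φ z : ℝ × ℝ) ∈ sphere (0 : ℝ × ℝ) 1}) :
    ∃ e : Z → ℂ, Topology.IsClosedEmbedding e ∧
      (∀ Ω : Set Z, IsOpen Ω → Disjoint Ω bdry → IsOpen (e '' Ω)) ∧
      ∀ z ∈ bdry, ∃ u : ℂ, u ≠ 0 ∧ ∀ z' ∉ bdry, 0 < (u * (e z' - e z)).re := by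
  let ψ := Complex.equivRealProdCLM.symm.toHomeomorph
  refine ⟨fun z ↦ ψ (φ z), ?_, fun Ω hΩ hdis ↦ ?_, fun z hz ↦ ?_⟩
  · refine Continuous.isClosedEmbedding (by fun_prop) fun x y hxy ↦ ?_
    exact φ.injective (Subtype.val_injective (ψ.injective hxy))
  · obtain ⟨O, hO, hOΩ⟩ := isOpen_induced_iff.1 (φ.isOpen_image.2 hΩ)
    have : (fun z ↦ ψ (φ z)) '' Ω = ψ '' (O ∩ ball 0 1) := by
      rw [← image_image ψ fun z ↦ (φ z : ℝ × ℝ)]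
      congr 1
      ext w
      constructor
      · rintro ⟨z, hz, rfl⟩
        have h1 : φ z ∈ Subtype.val ⁻¹' O := hOΩ ▸ mem_image_of_mem φ hz
        have h2 : z ∉ bdry := disjoint_left.1 hdis hz
        rw [hbdry] at h2
        exact ⟨h1, mem_ball.2 (lt_of_le_of_ne (φ z).2 h2)⟩
      · rintro ⟨hwO, hw⟩
        have : (⟨w, ball_subset_closedBall hw⟩ : closedBall (0 : ℝ × ℝ) 1) ∈ φ '' Ω := hOΩ ▸ hwO
        obtain ⟨z, hz, hzw⟩ := this
        exact ⟨z, hz, congrArg Subtype.val hzw⟩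
    rw [this]
    exact ψ.isOpen_image.2 (hO.inter isOpen_ball)
  · rw [hbdry] at hz
    have hz1 : max |(φ z : ℝ × ℝ).1| |(φ z : ℝ × ℝ).2| = 1 := by
      simpa [Prod.norm_def] using hz
    have hin : ∀ z' ∉ bdry, |(φ z' : ℝ × ℝ).1| < 1 ∧ |(φ z' : ℝ × ℝ).2| < 1 := by
      intro z' hz'
      rw [hbdry] at hz'
      have : ‖(φ z' : ℝ × ℝ)‖ < 1 := by
        refine lt_of_le_of_ne (mem_closedBall_zero_iff.1 (φ z').2) fun h ↦ hz' ?_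
        simpa using h
      simpa [Prod.norm_def] using this
    have hre : ∀ z, (ψ (φ z)).re = (φ z : ℝ × ℝ).1 := fun z ↦ rfl
    have him : ∀ z, (ψ (φ z)).im = (φ z : ℝ × ℝ).2 := fun z ↦ rfl
    rcases max_eq_iff.1 hz1 with ⟨h, -⟩ | ⟨h, -⟩ <;>
      rcases (abs_eq zero_le_one).1 h with h | h
    · refine ⟨-1, by simp, fun z' hz' ↦ ?_⟩
      simp only [Complex.mul_re, Complex.sub_re, Complex.sub_im, hre, him, h]
      simpa using (abs_lt.1 (hin z' hz').1).2
    · refine ⟨1, by simp, fun z' hz' ↦ ?_⟩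
      simp only [Complex.mul_re, Complex.sub_re, Complex.sub_im, hre, him, h]
      have := (abs_lt.1 (hin z' hz').1).1
      simp
      linarith
    · refine ⟨Complex.I, by simp, fun z' hz' ↦ ?_⟩
      simp only [Complex.mul_re, Complex.sub_re, Complex.sub_im, hre, him, h]
      simpa using (abs_lt.1 (hin z' hz').2).2
    · refine ⟨-Complex.I, by simp, fun z' hz' ↦ ?_⟩
      simp only [Complex.mul_re, Complex.sub_re, Complex.sub_im, hre, him, h]
      have := (abs_lt.1 (hin z' hz').2).1
      simp
      linarith

theorem IsGeodesicSpace.locallyConnectedSpace {Z : Type*} [MetricSpace Z]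
    (h : IsGeodesicSpace Z) : LocallyConnectedSpace Z := by
  refine locallyConnectedSpace_iff_subsets_isOpen_isConnected.2 fun x U hU ↦ ?_
  obtain ⟨r, hr, hrU⟩ := Metric.mem_nhds_iff.1 hU
  exact ⟨ball x r, hrU, isOpen_ball, mem_ball_self hr, ⟨x, mem_ball_self hr⟩,
    h.isPreconnected_ball x r⟩

theorem frontier_connectedComponentIn_compl_subset {X : Type*} [TopologicalSpace X]
    [LocallyConnectedSpace X] {T : Set X} (hT : IsClosed T) (x : X) :
    frontier (connectedComponentIn Tᶜ x) ⊆ T := by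
  intro y hy
  by_contra hyT
  have ho : IsOpen (connectedComponentIn Tᶜ x) := hT.isOpen_compl.connectedComponentIn
  rw [ho.frontier_eq] at hy
  have hx : x ∈ connectedComponentIn Tᶜ x := by
    obtain ⟨w, hw⟩ := closure_nonempty_iff.1 ⟨y, hy.1⟩
    exact mem_connectedComponentIn (connectedComponentIn_nonempty_iff.1 ⟨w, hw⟩)
  have hpre : IsPreconnected (insert y (connectedComponentIn Tᶜ x)) :=
    isPreconnected_connectedComponentIn.subset_closure (subset_insert _ _)
      (insert_subset hy.1 subset_closure)
  exact hy.2 (hpre.subset_connectedComponentIn (mem_insert_of_mem _ hx)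
    (insert_subset hyT (connectedComponentIn_subset _ _)) (mem_insert _ _))

/-- A function which has positive real part on `T` after a rotation has a logarithm on `T`. -/
theorem hasLogOn_of_re_mul_pos {X : Type*} [TopologicalSpace X] {f : X → ℂ} {T : Set X}
    (hf : ContinuousOn f T) {u : ℂ} (hu : u ≠ 0) (h : ∀ x ∈ T, 0 < (u * f x).re) :
    HasLogOn f T := by
  refine ⟨fun x ↦ Complex.log (u * f x) - Complex.log u,
    ((continuousOn_const.mul hf).clog fun x hx ↦ Or.inl (h x hx)).sub continuousOn_const,
    fun x hx ↦ ?_⟩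
  have h0 : u * f x ≠ 0 := fun h0 ↦ by simpa [h0] using h x hx
  rw [Complex.exp_sub, Complex.exp_log h0, Complex.exp_log hu, mul_div_cancel_left₀ _ hu]

section

variable {Z : Type*} [MetricSpace Z] [CompactSpace Z] [MeasurableSpace Z] [BorelSpace Z]

/-- A short sphere about `z₀` is nearly enclosed by a short Jordan curve. -/
theorem hausdorffMeasure_ball_sub_le (hgeo : IsGeodesicSpace Z)
    (φ : Z ≃ₜ ↥(closedBall (0 : ℝ × ℝ) 1)) {bdry : Set Z}
    (hbdry : bdry = {z : Z | (φ z : ℝ × ℝ) ∈ sphere (0 : ℝ × ℝ) 1}) {C l₀ : ℝ}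
    (hisop : ∀ T Ω : Set Z, Nonempty (↥T ≃ₜ Circle) →
      IsOpen Ω → IsConnected Ω → frontier Ω = T → Disjoint Ω bdry →
      μH[1] T < ENNReal.ofReal l₀ →
      μH[2] Ω ≤ ENNReal.ofReal C * (μH[1] T) ^ 2)
    {z₀ : Z} {s ε L : ℝ} (hε : 0 < ε) (hεs : ε < s) (hs : s + ε < infDist z₀ bdry)
    (hL : μH[1] (sphere z₀ s) < ENNReal.ofReal L) (hLl : L < l₀) :
    μH[2] (ball z₀ (s - ε)) ≤ ENNReal.ofReal C * ENNReal.ofReal L ^ 2 := by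
  have := hgeo.locallyConnectedSpace
  obtain ⟨e, he, heo, hebd⟩ := exists_planar_embedding φ hbdry
  have hbd : ∀ z, dist z z₀ ≤ s + ε → z ∉ bdry := fun z hz hzb ↦ by
    have := infDist_le_dist_of_mem (x := z₀) hzb
    rw [dist_comm] at this
    linarith
  set f : Z → ℂ := fun z ↦ e z - e z₀ with hf
  have hfc : Continuous f := he.continuous.sub continuous_const
  set N : Set Z := {z | s - ε ≤ dist z z₀ ∧ dist z z₀ ≤ s + ε} with hN
  have hNc : IsClosed N := by
    rw [hN, ofPred_and]
    exact (isClosed_le (by fun_prop) (by fun_prop)).inter (isClosed_le (by fun_prop) (by fun_prop))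
  have hfN : ∀ x ∈ N, f x ≠ 0 := fun x hx h0 ↦ by
    have : x = z₀ := he.injective (sub_eq_zero.1 h0)
    rw [hN, mem_ofPred_eq, this, dist_self] at hx
    linarith [hx.1]
  obtain ⟨c₀, hc₀, hc₀N⟩ : ∃ c₀ > 0, ∀ x ∈ N, c₀ ≤ ‖f x‖ := by
    rcases N.eq_empty_or_nonempty with h | h
    · exact ⟨1, one_pos, by simp [h]⟩
    · obtain ⟨x, hx, hxmin⟩ := hNc.isCompact.exists_isMinOn h hfc.norm.continuousOn
      exact ⟨‖f x‖, norm_pos_iff.2 (hfN x hx), fun y hy ↦ hxmin hy⟩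
  have hlog : ¬ HasLogOn f (sphere z₀ s) := fun h ↦ by
    refine not_hasLogOn_frontier_of_isClosedEmbedding he (isOpen_ball (x := z₀) (ε := s))
      (heo _ isOpen_ball (disjoint_left.2 fun z hz ↦ hbd z ?_))
      (mem_ball_self (hε.trans hεs)) (h.mono frontier_ball_subset_sphere)
    rw [mem_ball] at hz
    linarith
  obtain ⟨a, L', w, hw, hL', hloop⟩ := hgeo.exists_logPath hfc (isCompact_sphere z₀ s) hε
    (N := N) (fun x hx y hy ↦ by
      rw [mem_sphere] at hx
      rw [mem_ball] at hy
      have h1 := dist_triangle y x z₀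
      have h2 := dist_triangle_left x z₀ y
      constructor <;> linarith) hc₀ hc₀N hlog hL
  obtain ⟨ℓ, γ, θ, hℓ, hℓL, p, h0, hne, hinj⟩ := hloop.exists_injOn hfc hNc hfN hw
  have hγ := p.lipschitzOnWith.continuousOn
  set T := γ '' Icc 0 ℓ with hT
  have hTc : IsCompact T := isCompact_Icc.image_of_continuousOn hγ
  have hTN : T ⊆ N := by
    rintro _ ⟨t, ht, rfl⟩
    exact p.mem t ht
  have hTbd : ∀ x ∈ T, x ∉ bdry := fun x hx ↦ hbd x (hTN hx).2
  set Ω := connectedComponentIn Tᶜ z₀ with hΩ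
  have hBT : ball z₀ (s - ε) ⊆ Tᶜ := fun x hx hxT ↦ by
    rw [mem_ball] at hx
    linarith [(hTN hxT).1]
  have hz₀ : z₀ ∈ ball z₀ (s - ε) := mem_ball_self (by linarith)
  have hBΩ : ball z₀ (s - ε) ⊆ Ω :=
    (hgeo.isPreconnected_ball z₀ _).subset_connectedComponentIn hz₀ hBT
  have hΩo : IsOpen Ω := hTc.isClosed.isOpen_compl.connectedComponentIn
  have hΩT : Ω ⊆ Tᶜ := connectedComponentIn_subset _ _
  have hfr : frontier Ω ⊆ T := frontier_connectedComponentIn_compl_subset hTc.isClosed z₀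
  have hdis : Disjoint Ω bdry := disjoint_left.2 fun z₁ hz₁ hz₁b ↦ by
    obtain ⟨u, hu, hupos⟩ := hebd z₁ hz₁b
    refine p.not_hasLogOn_image h0 hne (HasLogOn.of_isPreconnected hTc he.continuous.continuousOn
      (isPreconnected_connectedComponentIn.image e he.continuous.continuousOn) ?_
      (mem_image_of_mem e (hBΩ hz₀)) (mem_image_of_mem e hz₁)
      (hasLogOn_of_re_mul_pos (he.continuous.sub continuous_const).continuousOn hu
        fun x hx ↦ hupos x (hTbd x hx)))
    rintro x hx ⟨y, hy, hyx⟩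
    exact hΩT hy (he.injective hyx ▸ hx)
  have hfrT : frontier Ω = T := by
    refine hfr.antisymm ?_
    by_contra hnot
    obtain ⟨_, ⟨t, ht, rfl⟩, htΩ⟩ := not_subset.1 hnot
    obtain ⟨t₀, ht₀, ht₀t⟩ : ∃ t₀ ∈ Ico 0 ℓ, γ t₀ = γ t := by
      rcases ht.2.eq_or_lt with rfl | hlt
      · exact ⟨0, ⟨le_rfl, hℓ⟩, h0⟩
      · exact ⟨t, ⟨ht.1, hlt⟩, rfl⟩
    exact not_hasLogOn_frontier_of_isClosedEmbedding he hΩo (heo Ω hΩo hdis) (hBΩ hz₀)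
      (p.hasLogOn_of_notMem h0 hinj isClosed_frontier hfr ht₀ (ht₀t ▸ htΩ))
  have hlen : μH[1] T ≤ ENNReal.ofReal L := by
    have := p.lipschitzOnWith.hausdorffMeasure_image_le zero_le_one
    rw [hausdorffMeasure_real, Real.volume_Icc] at this
    refine (this.trans_eq (by simp)).trans (ENNReal.ofReal_le_ofReal (hℓL.trans hL'))
  have hLpos : 0 < l₀ := by linarith
  calc μH[2] (ball z₀ (s - ε)) ≤ μH[2] Ω := measure_mono hBΩ
    _ ≤ ENNReal.ofReal C * (μH[1] T) ^ 2 :=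
      hisop T Ω (nonempty_homeomorph_circle hℓ hγ h0 hinj) hΩo
        ⟨⟨z₀, hBΩ hz₀⟩, isPreconnected_connectedComponentIn⟩ hfrT hdis
        (hlen.trans_lt ((ENNReal.ofReal_lt_ofReal_iff hLpos).2 hLl))
    _ ≤ ENNReal.ofReal C * ENNReal.ofReal L ^ 2 := by gcongr

theorem hausdorffMeasure_ball_le (hgeo : IsGeodesicSpace Z)
    (φ : Z ≃ₜ ↥(closedBall (0 : ℝ × ℝ) 1)) {bdry : Set Z}
    (hbdry : bdry = {z : Z | (φ z : ℝ × ℝ) ∈ sphere (0 : ℝ × ℝ) 1}) {C l₀ : ℝ}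
    (hisop : ∀ T Ω : Set Z, Nonempty (↥T ≃ₜ Circle) →
      IsOpen Ω → IsConnected Ω → frontier Ω = T → Disjoint Ω bdry →
      μH[1] T < ENNReal.ofReal l₀ →
      μH[2] Ω ≤ ENNReal.ofReal C * (μH[1] T) ^ 2)
    {z₀ : Z} {s : ℝ} (hs₀ : 0 < s) (hs : s < infDist z₀ bdry)
    (hl : μH[1] (sphere z₀ s) < ENNReal.ofReal l₀) :
    μH[2] (ball z₀ s) ≤ ENNReal.ofReal C * μH[1] (sphere z₀ s) ^ 2 := by
  set m := μH[1] (sphere z₀ s) with hm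
  have hmtop : m ≠ ∞ := hl.ne_top
  have hmoff : ENNReal.ofReal m.toReal = m := ENNReal.ofReal_toReal hmtop
  have hml : m.toReal < l₀ := ENNReal.toReal_lt_of_lt_ofReal hl
  have hball : ∀ L, m.toReal < L → L < l₀ →
      μH[2] (ball z₀ s) ≤ ENNReal.ofReal C * ENNReal.ofReal L ^ 2 := fun L hL hLl ↦ by
    obtain ⟨δ, hδ, hδs, hδb⟩ : ∃ δ > 0, δ < s ∧ s + δ < infDist z₀ bdry :=
      ⟨min s (infDist z₀ bdry - s) / 2, by
        have := lt_min hs₀ (sub_pos.2 hs)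
        positivity, by linarith [min_le_left s (infDist z₀ bdry - s)],
        by linarith [min_le_right s (infDist z₀ bdry - s)]⟩
    have hunion : ball z₀ s = ⋃ n : ℕ, ball z₀ (s - δ / (n + 1)) := by
      ext x
      simp only [mem_iUnion, mem_ball]
      refine ⟨fun hx ↦ ?_, fun ⟨n, hn⟩ ↦ hn.trans (sub_lt_self _ (by positivity))⟩
      obtain ⟨n, hn⟩ := exists_nat_gt (δ / (s - dist x z₀))
      refine ⟨n, ?_⟩
      rw [div_lt_iff₀ (sub_pos.2 hx)] at hn
      rw [lt_sub_comm, div_lt_iff₀ (by positivity)]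
      nlinarith
    have hmono : Monotone fun n : ℕ ↦ ball z₀ (s - δ / (n + 1)) := fun a b hab ↦ by
      refine ball_subset_ball ?_
      gcongr
    rw [hunion, hmono.measure_iUnion]
    refine iSup_le fun n ↦ hausdorffMeasure_ball_sub_le hgeo φ hbdry hisop (by positivity) ?_ ?_
      ?_ hLl
    · exact (div_le_self hδ.le (by simp)).trans_lt hδs
    · linarith [div_le_self hδ.le (show (1 : ℝ) ≤ n + 1 by simp)]
    · rw [← hm, ← hmoff]
      exact (ENNReal.ofReal_lt_ofReal_iff (ENNReal.toReal_nonneg.trans_lt hL)).2 hL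
  have hcont : Continuous fun L : ℝ ↦ ENNReal.ofReal C * ENNReal.ofReal L ^ 2 :=
    (ENNReal.continuous_const_mul ENNReal.ofReal_ne_top).comp
      ((ENNReal.continuous_pow 2).comp ENNReal.continuous_ofReal)
  have hlim := hcont.continuousWithinAt (s := Ioi m.toReal) (x := m.toReal)
  rw [← hmoff]
  refine ge_of_tendsto hlim ?_
  filter_upwards [Ioo_mem_nhdsGT hml] with L hL using hball L hL.1 hL.2

end

/-- The co-area inequality for `1`-Lipschitz functions and unnormalized Hausdorff measures. -/
theorem LipschitzWith.lintegral_hausdorffMeasure_fiber_le {X : Type*} [MetricSpace X]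
    [MeasurableSpace X] [BorelSpace X] {f : X → ℝ} (hf : LipschitzWith 1 f) (A : Set X) :
    ∫⁻ s, μH[1] (A ∩ f ⁻¹' {s}) ≤ μH[2] A := by
  rcases eq_or_ne (μH[2] A) ∞ with htop | htop
  · simp [htop]
  let ρ : ℕ → ℝ≥0∞ := fun n ↦ (n + 1 : ℝ≥0∞)⁻¹
  have hρ : ∀ n, 0 < ρ n := fun n ↦ ENNReal.inv_pos.2 (by finiteness)
  have hρlim : Filter.Tendsto ρ Filter.atTop (nhds 0) := by
    have := (Filter.tendsto_add_atTop_iff_nat 1).2 ENNReal.tendsto_inv_nat_nhds_zero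
    simpa [ρ] using this
  have hcover : ∀ n, ∃ t : ℕ → Set X, A ⊆ ⋃ i, t i ∧ (∀ i, ediam (t i) ≤ ρ n) ∧
      ∑' i, ediam (t i) ^ 2 ≤ μH[2] A + ρ n := fun n ↦ by
    have hlt : (⨅ (t : ℕ → Set X) (_ : A ⊆ ⋃ i, t i) (_ : ∀ i, ediam (t i) ≤ ρ n),
        ∑' i, ⨆ _ : (t i).Nonempty, ediam (t i) ^ (2 : ℝ)) < μH[2] A + ρ n := by
      refine lt_of_le_of_lt ?_ (ENNReal.lt_add_right htop (hρ n).ne')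
      rw [Measure.hausdorffMeasure_apply 2 A]
      exact le_iSup₂_of_le (ρ n) (hρ n) le_rfl
    simp only [iInf_lt_iff] at hlt
    obtain ⟨t, hAt, htρ, hsum⟩ := hlt
    refine ⟨t, hAt, htρ, (ENNReal.tsum_le_tsum fun i ↦ ?_).trans hsum.le⟩
    rcases (t i).eq_empty_or_nonempty with h | h
    · simp [h]
    · simp [h]
  choose t hAt htρ hsum using hcover
  let h : ℕ → ℝ → ℝ≥0∞ := fun n s ↦
    ∑' i, (closure (f '' t n i)).indicator (fun _ ↦ ediam (t n i)) s
  have hmeas : ∀ n i, Measurable ((closure (f '' t n i)).indicator fun _ ↦ ediam (t n i)) :=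
    fun n i ↦ measurable_const.indicator isClosed_closure.measurableSet
  have hpt : ∀ s, μH[1] (A ∩ f ⁻¹' {s}) ≤ Filter.liminf (fun n ↦ h n s) Filter.atTop := by
    intro s
    refine (Measure.hausdorffMeasure_le_liminf_tsum 1 (A ∩ f ⁻¹' {s}) ρ hρlim
      (fun n i ↦ t n i ∩ f ⁻¹' {s}) (.of_forall fun n i ↦
        (ediam_mono inter_subset_left).trans (htρ n i)) (.of_forall fun n x hx ↦ ?_)).trans
      (Filter.liminf_le_liminf (.of_forall fun n ↦ ENNReal.tsum_le_tsum fun i ↦ ?_))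
    · obtain ⟨i, hi⟩ := mem_iUnion.1 (hAt n hx.1)
      exact mem_iUnion.2 ⟨i, hi, hx.2⟩
    · rw [ENNReal.rpow_one]
      by_cases hs : s ∈ closure (f '' t n i)
      · rw [indicator_of_mem hs]
        exact ediam_mono inter_subset_left
      · have : t n i ∩ f ⁻¹' {s} = ∅ := by
          rw [eq_empty_iff_forall_notMem]
          rintro x ⟨hx, rfl⟩
          exact hs (subset_closure (mem_image_of_mem f hx))
        simp [this]
  have hintegral : ∀ n, ∫⁻ s, h n s ≤ μH[2] A + ρ n := fun n ↦ by
    rw [lintegral_tsum fun i ↦ (hmeas n i).aemeasurable]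
    refine (ENNReal.tsum_le_tsum fun i ↦ ?_).trans (hsum n)
    rw [lintegral_indicator_const isClosed_closure.measurableSet, sq]
    gcongr
    calc volume (closure (f '' t n i)) ≤ ediam (closure (f '' t n i)) := Real.volume_le_diam _
      _ = ediam (f '' t n i) := ediam_closure _
      _ ≤ ediam (t n i) := by simpa using hf.ediam_image_le (t n i)
  calc ∫⁻ s, μH[1] (A ∩ f ⁻¹' {s}) ≤ ∫⁻ s, Filter.liminf (fun n ↦ h n s) Filter.atTop :=
        lintegral_mono hpt
    _ ≤ Filter.liminf (fun n ↦ ∫⁻ s, h n s) Filter.atTop :=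
        lintegral_liminf_le fun n ↦ Measurable.tsum (hmeas n)
    _ ≤ Filter.liminf (fun n ↦ μH[2] A + ρ n) Filter.atTop :=
        Filter.liminf_le_liminf (.of_forall hintegral)
    _ = μH[2] A := by
        have := (tendsto_const_nhds (x := μH[2] A)).add hρlim
        rw [add_zero] at this
        exact this.liminf_eq

/-- A function with `y b - y a ≥ k (b - a) √(y a)` grows at least quadratically. -/
theorem sq_le_of_mul_sqrt_le_sub {y : ℝ → ℝ} {k r : ℝ} (hk : 0 < k) (hr : 0 < r)
    (hy : ∀ a, 0 < a → a ≤ r → 0 < y a)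
    (h : ∀ a b, 0 < a → a ≤ b → b ≤ r → k * (b - a) * √(y a) ≤ y b - y a) :
    (k * r / 2) ^ 2 ≤ y r := by
  have hpos : ∀ a, 0 < a → a ≤ r → 0 < √(y a) := fun a ha har ↦ Real.sqrt_pos.2 (hy a ha har)
  have hsq : ∀ a, 0 < a → a ≤ r → √(y a) ^ 2 = y a := fun a ha har ↦
    Real.sq_sqrt (hy a ha har).le
  have hmono : ∀ a b, 0 < a → a ≤ b → b ≤ r → √(y a) ≤ √(y b) := fun a b ha hab hb ↦ by
    refine Real.sqrt_le_sqrt ?_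
    have := h a b ha hab hb
    have : 0 ≤ k * (b - a) * √(y a) :=
      mul_nonneg (mul_nonneg hk.le (sub_nonneg.2 hab)) (Real.sqrt_nonneg _)
    linarith
  have hlin : ∀ c a, 0 < c → c < k / 2 → 0 < a → a ≤ r → c * (r - a) ≤ √(y r) := by
    intro c a₀ hc hck ha₀ ha₀r
    obtain ⟨δ, hδ, hδc⟩ : ∃ δ > 0, c ^ 2 * δ = (k - 2 * c) * √(y a₀) := by
      refine ⟨(k - 2 * c) * √(y a₀) / c ^ 2, ?_, by field_simp⟩
      have : 0 < k - 2 * c := by linarith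
      have := hpos a₀ ha₀ ha₀r
      positivity
    have hstep : ∀ a b, a₀ ≤ a → a ≤ b → b ≤ a + δ → b ≤ r →
        √(y a) + c * (b - a) ≤ √(y b) := by
      intro a b ha hab hbδ hbr
      have ha' : 0 < a := ha₀.trans_le ha
      by_contra! hlt
      have h1 := h a b ha' hab hbr
      rw [← hsq a ha' (hab.trans hbr), ← hsq b (ha'.trans_le hab) hbr,
        Real.sqrt_sq (Real.sqrt_nonneg _)] at h1
      have h2 : √(y b) ^ 2 < (√(y a) + c * (b - a)) ^ 2 :=
        pow_lt_pow_left₀ hlt (Real.sqrt_nonneg _) two_ne_zero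
      have h3 : c ^ 2 * (b - a) ≤ (k - 2 * c) * √(y a) := by
        calc c ^ 2 * (b - a) ≤ c ^ 2 * δ := by gcongr; linarith
          _ = (k - 2 * c) * √(y a₀) := hδc
          _ ≤ (k - 2 * c) * √(y a) := by
            have := hmono a₀ a ha₀ ha (hab.trans hbr)
            have : 0 < k - 2 * c := by linarith
            gcongr
      nlinarith [mul_le_mul_of_nonneg_right h3 (sub_nonneg.2 hab)]
    have hiter : ∀ n : ℕ, ∀ b, a₀ ≤ b → b ≤ r → b ≤ a₀ + n * δ → c * (b - a₀) ≤ √(y b) := by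
      intro n
      induction n with
      | zero =>
        intro b hb _ hbn
        have : b = a₀ := le_antisymm (by simpa using hbn) hb
        simp [this]
      | succ n ih =>
        intro b hb hbr hbn
        push_cast at hbn
        have h1 := ih (max a₀ (b - δ)) (le_max_left _ _)
          (max_le (hb.trans hbr) (by linarith)) (max_le (by nlinarith [n.cast_nonneg (α := ℝ)])
            (by linarith))
        have h2 := hstep (max a₀ (b - δ)) b (le_max_left _ _) (max_le hb (by linarith))
          (by linarith [le_max_right a₀ (b - δ)]) hbr
        linarith
    obtain ⟨n, hn⟩ := exists_nat_ge ((r - a₀) / δ)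
    rw [div_le_iff₀ hδ] at hn
    exact hiter n r ha₀r le_rfl (by linarith)
  have hlim : Filter.Tendsto (fun c : ℝ ↦ c * (k / 2) * (r - (1 - c) * r)) (nhdsWithin 1 (Iio 1))
      (nhds (1 * (k / 2) * (r - (1 - 1) * r))) :=
    (by fun_prop : Continuous fun c : ℝ ↦ c * (k / 2) * (r - (1 - c) * r)).continuousWithinAt
  have hle : k * r / 2 ≤ √(y r) := by
    refine (show k * r / 2 = 1 * (k / 2) * (r - (1 - 1) * r) by ring).trans_le
      (le_of_tendsto hlim ?_)
    filter_upwards [Ioo_mem_nhdsLT (zero_lt_one (α := ℝ))] with c hc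
    refine hlin _ _ (mul_pos hc.1 (by positivity)) ?_ (mul_pos (sub_pos.2 hc.2) hr) ?_
    · nlinarith [hc.2]
    · nlinarith [hc.1]
  rw [← hsq r hr le_rfl]
  gcongr

theorem add_hausdorffMeasure_sphere_le {Z : Type*} [MetricSpace Z] [MeasurableSpace Z]
    [BorelSpace Z] {z₀ : Z} {a b : ℝ} (hab : a ≤ b) {m : ℝ≥0∞}
    (hm : ∀ s ∈ Ico a b, m ≤ μH[1] (sphere z₀ s)) :
    μH[2] (ball z₀ a) + ENNReal.ofReal (b - a) * m ≤ μH[2] (ball z₀ b) := by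
  have hsub : ball z₀ a ⊆ ball z₀ b := ball_subset_ball hab
  have hcoarea := (LipschitzWith.dist_left z₀).lintegral_hausdorffMeasure_fiber_le
    (ball z₀ b \ ball z₀ a)
  rw [← measure_inter_add_sdiff (ball z₀ b) (measurableSet_ball (x := z₀) (ε := a)),
    inter_eq_self_of_subset_right hsub]
  gcongr
  refine le_trans ?_ hcoarea
  calc ENNReal.ofReal (b - a) * m = ∫⁻ _ in Ico a b, m := by
        rw [setLIntegral_const, Real.volume_Ico, mul_comm]
    _ ≤ ∫⁻ s in Ico a b, μH[1] (ball z₀ b \ ball z₀ a ∩ (fun x ↦ dist x z₀) ⁻¹' {s}) := by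
        refine setLIntegral_mono' measurableSet_Ico fun s hs ↦ (hm s hs).trans
          (measure_mono fun x hx ↦ ?_)
        rw [mem_sphere] at hx
        simp [hx, hs.1, hs.2]
    _ ≤ _ := setLIntegral_le_lintegral _ _

/-- **quadratic lower area growth from the isoperimetric inequality.**
Let `Z` be a geodesic metric space homeomorphic to the closed disc, with boundary circle
`∂Z`, such that every Jordan curve `T` of length (`ℋ¹`-measure) `< l₀` bounds a Jordan
domain `Ω` with `ℋ²(Ω) ≤ C ℓ(T)²`, and suppose all balls of `Z` have positive
`ℋ²`-measure. Then for every `z₀ ∈ Z` and `0 ≤ r < d(z₀, ∂Z)`,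
`ℋ²(B(z₀,r)) ≥ min{ (π²/(64 C)) r², C l₀² }`. -/
theorem area_growth_from_isoperimetric
    (Z : Type*) [MetricSpace Z] [CompactSpace Z]
    [MeasurableSpace Z] [BorelSpace Z]
    (hgeo : IsGeodesicSpace Z)
    (φ : Z ≃ₜ ↥(Metric.closedBall (0 : ℝ × ℝ) 1))
    (bdry : Set Z)
    (hbdry : bdry = {z : Z | ((φ z : ℝ × ℝ)) ∈ Metric.sphere (0 : ℝ × ℝ) 1})
    (C l₀ : ℝ) (hC : 0 < C) (hl₀ : 0 < l₀)
    (hisop : ∀ T Ω : Set Z, Nonempty (↥T ≃ₜ Circle) →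
      IsOpen Ω → IsConnected Ω → frontier Ω = T → Disjoint Ω bdry →
      μH[1] T < ENNReal.ofReal l₀ →
      μH[2] Ω ≤ ENNReal.ofReal C * (μH[1] T) ^ 2)
    (hpos : ∀ (z : Z) (r : ℝ), 0 < r → 0 < μH[2] (Metric.ball z r)) :
    ∀ (z₀ : Z) (r : ℝ), 0 ≤ r → r < Metric.infDist z₀ bdry →
      min (ENNReal.ofReal (π ^ 2 / (64 * C) * r ^ 2)) (ENNReal.ofReal (C * l₀ ^ 2)) ≤
        μH[2] (Metric.ball z₀ r) := by
  intro z₀ r hr₀ hr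
  rcases hr₀.eq_or_lt with rfl | hr₀
  · simp
  by_contra! hlt
  obtain ⟨hlt₁, hlt₂⟩ := lt_min_iff.1 hlt
  have hmono : ∀ {a b}, a ≤ b → μH[2] (ball z₀ a) ≤ μH[2] (ball z₀ b) := fun hab ↦
    measure_mono (ball_subset_ball hab)
  have hfin : ∀ {a}, a ≤ r → μH[2] (ball z₀ a) ≠ ∞ := fun ha ↦
    ((hmono ha).trans_lt hlt₁).ne_top
  let y : ℝ → ℝ := fun a ↦ (μH[2] (ball z₀ a)).toReal
  have hsphere : ∀ s, 0 < s → s ≤ r →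
      μH[2] (ball z₀ s) ≤ ENNReal.ofReal C * μH[1] (sphere z₀ s) ^ 2 := by
    intro s hs hsr
    rcases lt_or_ge (μH[1] (sphere z₀ s)) (ENNReal.ofReal l₀) with h | h
    · exact hausdorffMeasure_ball_le hgeo φ hbdry hisop hs (hsr.trans_lt hr) h
    · refine ((hmono hsr).trans hlt₂.le).trans ?_
      rw [ENNReal.ofReal_mul hC.le, ENNReal.ofReal_pow hl₀.le]
      gcongr
  have hlow : ∀ a s, 0 < a → a ≤ s → s ≤ r →
      ENNReal.ofReal (√(y a / C)) ≤ μH[1] (sphere z₀ s) := by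
    intro a s ha has hsr
    by_contra! hm
    have hy : 0 ≤ y a / C := div_nonneg ENNReal.toReal_nonneg hC.le
    refine absurd ((hmono has).trans (hsphere s (ha.trans_le has) hsr)) (not_le.2 ?_)
    calc ENNReal.ofReal C * μH[1] (sphere z₀ s) ^ 2
        < ENNReal.ofReal C * ENNReal.ofReal (√(y a / C)) ^ 2 :=
          ENNReal.mul_lt_mul_right (ENNReal.ofReal_pos.2 hC).ne' ENNReal.ofReal_ne_top
            (ENNReal.pow_right_strictMono two_ne_zero hm)
      _ = μH[2] (ball z₀ a) := by
          rw [← ENNReal.ofReal_pow (Real.sqrt_nonneg _), Real.sq_sqrt hy,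
            ← ENNReal.ofReal_mul hC.le, mul_div_cancel₀ _ hC.ne',
            ENNReal.ofReal_toReal (hfin (has.trans hsr))]
  have hode := sq_le_of_mul_sqrt_le_sub (y := y) (k := 1 / √C) (r := r) (by positivity) hr₀
    (fun a ha har ↦ ENNReal.toReal_pos (hpos z₀ a ha).ne' (hfin har)) fun a b ha hab hbr ↦ by
      have h := add_hausdorffMeasure_sphere_le (z₀ := z₀) hab
        fun s hs ↦ hlow a s ha hs.1 (hs.2.le.trans hbr)
      rw [← ENNReal.ofReal_mul (sub_nonneg.2 hab), ← ENNReal.ofReal_toReal (hfin (hab.trans hbr)),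
        ← ENNReal.ofReal_add ENNReal.toReal_nonneg (by
          have := sub_nonneg.2 hab
          positivity),
        ← ENNReal.ofReal_toReal (hfin hbr), ENNReal.ofReal_le_ofReal_iff ENNReal.toReal_nonneg,
        Real.sqrt_div' _ hC.le] at h
      calc 1 / √C * (b - a) * √(y a) = (b - a) * (√(y a) / √C) := by ring
        _ ≤ y b - y a := by simp only [y]; linarith
  have hyr : y r < π ^ 2 / (64 * C) * r ^ 2 := ENNReal.toReal_lt_of_lt_ofReal hlt₁
  have heq : (1 / √C * r / 2) ^ 2 = r ^ 2 / (4 * C) := by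
    field_simp
    rw [Real.sq_sqrt hC.le]
    ring
  have hπ : π ^ 2 / (64 * C) * r ^ 2 ≤ r ^ 2 / (4 * C) := by
    have : π ^ 2 ≤ 16 := by nlinarith [Real.pi_pos, Real.pi_le_four]
    calc π ^ 2 / (64 * C) * r ^ 2 ≤ 16 / (64 * C) * r ^ 2 := by gcongr
      _ = r ^ 2 / (4 * C) := by field_simp; norm_num
  linarith
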